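/- Suppose that for a sequence α_n ↑ 1 either (a) Assumptions W*, B̲_{{α_n}}, and LEC_{{α_n}} hold, or (b) Assumptions S*, B̲_{{α_n}}, LEC_{{α_n}}(ii), and LEC_{{α_n}}(iii) hold. If, in addition, lim_{n→∞} (1−α_n) m_{α_n} = w̲, then w* = w̄ = w̲, and there exists a deterministic policy φ such that, with u(x) := lim_{n→∞} u_{α_n}(x), the ACOE holds with w̲ in place of w*: for all x ∈ X, w̲ + u(x) = c(x,φ(x)) + ∫_X u(y) q(dy|x,φ(x)) = min_{a∈A} [ c(x,a) + ∫_X u(y) q(dy|x,a) ]. -/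

import Mathlib

open MeasureTheory ProbabilityTheory Filter Topology Set
open scoped ENNReal NNReal

noncomputable section

/-- The nonnegative part of an extended real, as an element of `ℝ≥0∞`. -/
def eToENN (x : EReal) : ℝ≥0∞ := if x = ⊤ then ⊤ else ENNReal.ofReal x.toReal

/-- Extended integral of an `EReal`-valued function: positive part minus negative part. -/
def eInt {Y : Type*} [MeasurableSpace Y] (μ : Measure Y) (f : Y → EReal) : EReal :=
  ((∫⁻ y, eToENN (f y) ∂μ : ℝ≥0∞) : EReal) - ((∫⁻ y, eToENN (-(f y)) ∂μ : ℝ≥0∞) : EReal)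

/-- Extended sum of an `EReal`-valued series: positive part minus negative part. -/
def eSum (f : ℕ → EReal) : EReal :=
  ((∑' t, eToENN (f t) : ℝ≥0∞) : EReal) - ((∑' t, eToENN (-(f t)) : ℝ≥0∞) : EReal)

/-- Histories of length `t`: `(X × A) ^ t × X`. -/
abbrev Hist (X A : Type*) (t : ℕ) := (Fin t → X × A) × X

/-- A (randomized, history-dependent) policy: a regular transition probability from
histories to actions, at every time epoch. -/
structure Policy (X A : Type*) [MeasurableSpace X] [MeasurableSpace A] where
  π : ∀ t : ℕ, Kernel (Hist X A t) A
  markov : ∀ t, IsMarkovKernel (π t)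

/-- A Markov decision process with state space `X`, action space `A`, one-step cost `c`
(measurable and bounded below, with values in `(-∞, +∞]`) and transition probability `q`. -/
structure MDP (X A : Type*) [MeasurableSpace X] [MeasurableSpace A] where
  c : X → A → EReal
  q : Kernel (X × A) X
  markov : IsMarkovKernel q
  c_meas : Measurable fun p : X × A => c p.1 p.2
  c_ne_bot : ∃ K : ℝ, ∀ x a, (K : EReal) ≤ c x a

variable {X A : Type*} [MeasurableSpace X] [MeasurableSpace A]

/-- The deterministic policy given by a measurable map `φ : X → A` applied to the current state. -/
def detPolicy (φ : X → A) (hφ : Measurable φ) : Policy X A :=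
  ⟨fun t => Kernel.deterministic (fun h : Hist X A t => φ h.2) (hφ.comp measurable_snd),
   fun _ => by infer_instance⟩

/-- The distribution `P_x^π` of the history `h_t`, constructed recursively
(Ionescu-Tulcea finite-dimensional marginals). -/
def histMeas (M : MDP X A) (p : Policy X A) (x : X) : ∀ t : ℕ, Measure (Hist X A t)
  | 0 => Measure.dirac (Fin.elim0, x)
  | (t + 1) =>
      (histMeas M p x t).bind fun h =>
        ((p.π t) h).bind fun a =>
          (M.q (h.2, a)).map fun x' => (Fin.snoc h.1 (h.2, a), x')

/-- The joint distribution of the state-action pair `(x_t, a_t)` under `P_x^π`. -/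
def saMeas (M : MDP X A) (p : Policy X A) (x : X) (t : ℕ) : Measure (X × A) :=
  (histMeas M p x t).bind fun h => ((p.π t) h).map fun a => (h.2, a)

/-- `E_x^π c(x_t, a_t)`. -/
def expCost (M : MDP X A) (p : Policy X A) (x : X) (t : ℕ) : EReal :=
  eInt (saMeas M p x t) fun sa => M.c sa.1 sa.2

/-- The expected total discounted cost `v_α^π(x) = E_x^π ∑_t α^t c(x_t, a_t)`. -/
def vDisc (M : MDP X A) (α : ℝ) (p : Policy X A) (x : X) : EReal :=
  eSum fun t => ((α ^ t : ℝ) : EReal) * expCost M p x t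

/-- The finite-horizon expected total (undiscounted) cost `v_{N,1}^π(x)`. -/
def vFin (M : MDP X A) (N : ℕ) (p : Policy X A) (x : X) : EReal :=
  ∑ t ∈ Finset.range N, expCost M p x t

/-- The discounted value function `v_α(x) = inf_π v_α^π(x)`. -/
def vDiscOpt (M : MDP X A) (α : ℝ) (x : X) : EReal :=
  ⨅ p : Policy X A, vDisc M α p x

/-- The average cost per unit time `w^π(x)`. -/
def avgCost (M : MDP X A) (p : Policy X A) (x : X) : EReal :=
  Filter.limsup (fun N : ℕ => (((N : ℝ)⁻¹ : ℝ) : EReal) * vFin M N p x) atTop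

/-- The optimal average cost `w(x) = inf_π w^π(x)`. -/
def avgOpt (M : MDP X A) (x : X) : EReal :=
  ⨅ p : Policy X A, avgCost M p x

/-- `w* = inf_x w(x)`. -/
def wStar (M : MDP X A) : EReal := ⨅ x : X, avgOpt M x

/-- `m_α = inf_x v_α(x)`. -/
def mDisc (M : MDP X A) (α : ℝ) : EReal := ⨅ x : X, vDiscOpt M α x

/-- The discounted relative value function `u_α(x) = v_α(x) - m_α`. -/
def uDisc (M : MDP X A) (α : ℝ) (x : X) : EReal := vDiscOpt M α x - mDisc M α

/-- `w̄ = limsup_{α↑1} (1-α) m_α`. -/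
def wBar (M : MDP X A) : EReal :=
  Filter.limsup (fun α : ℝ => ((1 - α : ℝ) : EReal) * mDisc M α) (𝓝[Set.Ico (0:ℝ) 1] 1)

/-- `w̲ = liminf_{α↑1} (1-α) m_α`. -/
def wLow (M : MDP X A) : EReal :=
  Filter.liminf (fun α : ℝ => ((1 - α : ℝ) : EReal) * mDisc M α) (𝓝[Set.Ico (0:ℝ) 1] 1)

/-- `w̄_{{α_n}} = limsup_n (1-α_n) m_{α_n}`. -/
def wBarSeq (M : MDP X A) (a : ℕ → ℝ) : EReal :=
  Filter.limsup (fun n : ℕ => ((1 - a n : ℝ) : EReal) * mDisc M (a n)) atTop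

/-- `w̲_{{α_n}} = liminf_n (1-α_n) m_{α_n}`. -/
def wLowSeq (M : MDP X A) (a : ℕ → ℝ) : EReal :=
  Filter.liminf (fun n : ℕ => ((1 - a n : ℝ) : EReal) * mDisc M (a n)) atTop


section TopologicalAssumptions

variable {X A : Type*} [MetricSpace X] [TopologicalSpace.SeparableSpace X]
  [MeasurableSpace X] [BorelSpace X] [StandardBorelSpace X]
  [MetricSpace A] [TopologicalSpace.SeparableSpace A]
  [MeasurableSpace A] [BorelSpace A] [StandardBorelSpace A]

/-- Assumption W*(i): the cost `c` is `K`-inf-compact, i.e., for every nonempty compact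
`K ⊆ X`, the restriction of `c` to `K × A` has compact sublevel sets. -/
def AssumptionWi (M : MDP X A) : Prop :=
  ∀ K : Set X, K.Nonempty → IsCompact K →
    ∀ lam : ℝ, IsCompact {p : X × A | p.1 ∈ K ∧ M.c p.1 p.2 ≤ (lam : EReal)}

/-- Assumption W*(ii): the transition probability `q(·|x,a)` is weakly continuous in `(x,a)`. -/
def AssumptionWii (M : MDP X A) : Prop :=
  ∀ f : BoundedContinuousFunction X ℝ, Continuous fun p : X × A => ∫ y, f y ∂ (M.q p)

/-- Assumption S*(i): for each `x`, the function `a ↦ c(x,a)` has compact sublevel sets. -/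
def AssumptionSi (M : MDP X A) : Prop :=
  ∀ x : X, ∀ lam : ℝ, IsCompact {a : A | M.c x a ≤ (lam : EReal)}

/-- Assumption S*(ii): for each `x`, the transition probability `q(·|x,a)` is setwise
continuous in `a`. -/
def AssumptionSii (M : MDP X A) : Prop :=
  ∀ x : X, ∀ B : Set X, MeasurableSet B → Continuous fun a : A => M.q (x, a) B

end TopologicalAssumptions

section Statements

variable {X A : Type*} [MetricSpace X] [TopologicalSpace.SeparableSpace X]
  [MeasurableSpace X] [BorelSpace X] [StandardBorelSpace X]
  [MetricSpace A] [TopologicalSpace.SeparableSpace A]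
  [MeasurableSpace A] [BorelSpace A] [StandardBorelSpace A]

/-- The pointwise limit `u(x) = lim_{n→∞} u_{α_n}(x)` (realized as a lower limit,
which equals the limit whenever the latter exists). -/
def uPointwise (M : MDP X A) (a : ℕ → ℝ) (x : X) : EReal :=
  Filter.liminf (fun n : ℕ => uDisc M (a n) x) atTop

/-- Assumption LEC_{{α_n}}(i): lower semi-equicontinuity of `{u_{α_n}}` on `X`. -/
def LECone (M : MDP X A) (a : ℕ → ℝ) : Prop :=
  ∀ x : X, ∀ ε : ℝ, 0 < ε → ∃ δ > (0 : ℝ), ∀ y : X, dist y x < δ →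
    ∀ n : ℕ, uDisc M (a n) x - (ε : EReal) < uDisc M (a n) y

/-- Assumption LEC_{{α_n}}(ii): pointwise convergence of `u_{α_n}` to a finite limit. -/
def LECtwo (M : MDP X A) (a : ℕ → ℝ) : Prop :=
  ∀ x : X, ∃ L : ℝ, Tendsto (fun n : ℕ => uDisc M (a n) x) atTop (𝓝 (L : EReal))

/-- Assumption LEC_{{α_n}}(iii): asymptotic uniform integrability of `{u_{α_n}}` with
respect to `q(·|x,a)`. -/
def LECthree (M : MDP X A) (a : ℕ → ℝ) : Prop :=
  ∀ x : X, ∀ b : A,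
    Tendsto (fun K : ℝ => Filter.limsup (fun n : ℕ =>
        ∫⁻ y in {y : X | (K : EReal) ≤ uDisc M (a n) y},
          eToENN (uDisc M (a n) y) ∂ (M.q (x, b))) atTop)
      atTop (𝓝 (0 : ℝ≥0∞))

end Statements

/-- **Novikov's separation theorem**: countably many analytic sets with empty intersection can be
enlarged to measurable sets with empty intersection. -/
theorem exists_measurable_superset_iInter_eq_empty {Y : Type*} [TopologicalSpace Y] [T2Space Y]
    [MeasurableSpace Y] [OpensMeasurableSpace Y] {S : ℕ → Set Y} (hS : ∀ n, AnalyticSet (S n))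
    (hempty : ⋂ n, S n = ∅) :
    ∃ B : ℕ → Set Y, (∀ n, S n ⊆ B n) ∧ (∀ n, MeasurableSet (B n)) ∧ ⋂ n, B n = ∅ := by
  classical
  by_cases hne : ∃ n, S n = ∅
  · obtain ⟨n, hn⟩ := hne
    refine ⟨fun m => if m = n then ∅ else univ, fun m => ?_, fun m => ?_, ?_⟩
    · by_cases h : m = n
      · subst h; simp [hn]
      · simp [h]
    · by_cases h : m = n <;> simp [h]
    · refine eq_empty_of_subset_empty fun y hy => ?_
      simpa using mem_iInter.1 hy n
  have hf : ∀ n, ∃ f : (ℕ → ℕ) → Y, Continuous f ∧ range f = S n := fun n =>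
    (by simpa only [AnalyticSet_def] using hS n : S n = ∅ ∨ _).resolve_left fun h => hne ⟨n, h⟩
  choose f fc fr using hf
  set Sep : (ℕ → Set Y) → Prop := fun R =>
    ∃ B : ℕ → Set Y, (∀ n, R n ⊆ B n) ∧ (∀ n, MeasurableSet (B n)) ∧ ⋂ n, B n = ∅ with hSep
  set P : (ℕ → ℕ) → ℕ → ℕ → Set Y := fun z t n =>
    f n '' {y | ∀ j, Nat.pair n j < t → y j = z (Nat.pair n j)} with hP
  have step : ∀ z t, ¬ Sep (P z t) → ∃ i, ¬ Sep (P (Function.update z t i) (t + 1)) := by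
    intro z t hnot
    by_contra! hall
    choose B hB1 hB2 hB3 using hall
    refine hnot ⟨fun n => if n = (Nat.unpair t).1 then ⋃ i, B i n else ⋂ i, B i n, ?_, ?_, ?_⟩
    · rintro n _ ⟨y, hy, rfl⟩
      have key : ∀ i, (n = (Nat.unpair t).1 → i = y (Nat.unpair t).2) → f n y ∈ B i n := by
        intro i hi
        refine hB1 i n ⟨y, fun j hj => ?_, rfl⟩
        rcases (Nat.lt_succ_iff.1 hj).lt_or_eq with h | h
        · rw [hy j h, Function.update_of_ne h.ne]
        · have := congrArg Nat.unpair h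
          simp only [Nat.unpair_pair] at this
          rw [h, Function.update_self, hi (by rw [← this]), ← this]
      by_cases hn : n = (Nat.unpair t).1
      · simp only [if_pos hn]
        exact mem_iUnion.2 ⟨_, key _ fun _ => rfl⟩
      · simp only [if_neg hn]
        exact mem_iInter.2 fun i => key i fun h => absurd h hn
    · intro n
      by_cases hn : n = (Nat.unpair t).1
      · simp only [if_pos hn]; exact MeasurableSet.iUnion fun i => hB2 i n
      · simp only [if_neg hn]; exact MeasurableSet.iInter fun i => hB2 i n
    · refine eq_empty_of_subset_empty fun y hy => ?_
      rw [mem_iInter] at hy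
      have h0 := hy (Nat.unpair t).1
      simp only [if_true] at h0
      obtain ⟨i, hi⟩ := mem_iUnion.1 h0
      rw [← hB3 i, mem_iInter]
      intro n
      by_cases hn : n = (Nat.unpair t).1
      · rw [hn]; exact hi
      · have := hy n
        simp only [if_neg hn] at this
        exact mem_iInter.1 this i
  by_contra hnot
  have hnot0 : ¬ Sep (P 0 0) := by
    have : P 0 0 = S := by
      funext n
      simp [hP, ← fr n]
    rw [this]; exact hnot
  choose! nxt hnxt using step
  let Z : ℕ → (ℕ → ℕ) := fun t => Nat.rec 0 (fun t z => Function.update z t (nxt z t)) t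
  have hZs : ∀ t, Z (t + 1) = Function.update (Z t) t (nxt (Z t) t) := fun _ => rfl
  have hZ : ∀ t, ¬ Sep (P (Z t) t) := by
    intro t
    induction t with
    | zero => exact hnot0
    | succ t ih => rw [hZs]; exact hnxt _ _ ih
  set z : ℕ → ℕ := fun t => Z (t + 1) t with hz
  have hZz : ∀ t s, s < t → Z t s = z s := by
    intro t
    induction t with
    | zero => intro s hs; omega
    | succ t ih =>
      intro s hs
      rcases (Nat.lt_succ_iff.1 hs).lt_or_eq with h | h
      · rw [hZs, Function.update_of_ne h.ne, ih s h]
      · rw [h]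
  have hPz : ∀ t, ¬ Sep (P z t) := by
    intro t
    have : P z t = P (Z t) t := by
      funext n
      simp only [hP]
      congr 1
      ext y
      refine forall_congr' fun j => forall_congr' fun hj => ?_
      rw [hZz t _ hj]
    rw [this]; exact hZ t
  set y : ℕ → ℕ → ℕ := fun n j => z (Nat.pair n j) with hy
  have hdiff : ∃ n m, f n (y n) ≠ f m (y m) := by
    by_contra! hall
    have : f 0 (y 0) ∈ ⋂ n, S n := mem_iInter.2 fun n => by
      rw [← fr n, hall 0 n]; exact mem_range_self _
    rw [hempty] at this
    exact this
  obtain ⟨n, m, hnm⟩ := hdiff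
  have hnm' : n ≠ m := fun h => hnm (by rw [h])
  obtain ⟨U, V, hU, hV, hnU, hmV, hUV⟩ := t2_separation hnm
  have small : ∀ k W, IsOpen W → f k (y k) ∈ W → ∃ t0, ∀ t ≥ t0, P z t k ⊆ W := by
    intro k W hW hk
    have hopen : IsOpen (f k ⁻¹' W) := hW.preimage (fc k)
    obtain ⟨I, u, hu, hsub⟩ := isOpen_pi_iff.1 hopen (y k) hk
    refine ⟨(I.sup fun j => Nat.pair k j) + 1, fun t ht => ?_⟩
    rintro _ ⟨x, hx, rfl⟩
    refine hsub fun j hj => ?_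
    have hj' : Nat.pair k j ≤ I.sup fun j => Nat.pair k j :=
      Finset.le_sup (f := fun j => Nat.pair k j) hj
    rw [hx j (by omega)]
    exact (hu j hj).2
  obtain ⟨t1, ht1⟩ := small n U hU hnU
  obtain ⟨t2, ht2⟩ := small m V hV hmV
  refine hPz (max t1 t2) ⟨fun k => if k = n then U else if k = m then V else univ, ?_, ?_, ?_⟩
  · intro k
    by_cases h1 : k = n
    · subst h1; simpa using ht1 _ (le_max_left _ _)
    · by_cases h2 : k = m
      · subst h2; simpa [h1] using ht2 _ (le_max_right _ _)
      · simp [h1, h2]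
  · intro k
    by_cases h1 : k = n
    · simpa [h1] using hU.measurableSet
    · by_cases h2 : k = m
      · simpa [h1, h2, hnm'.symm] using hV.measurableSet
      · simp [h1, h2]
  · refine eq_empty_of_subset_empty fun x hx => ?_
    rw [mem_iInter] at hx
    have hn := hx n
    have hm := hx m
    simp only [if_true, if_neg hnm'.symm] at hn hm
    exact disjoint_left.1 hUV hn hm

/-- The projection of a measurable set with compact sections along a compact factor is
measurable. -/
theorem measurableSet_fst_image_of_isCompact_sections_of_compactSpace {X C : Type*}
    [MeasurableSpace X] [StandardBorelSpace X] [TopologicalSpace C] [PolishSpace C]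
    [CompactSpace C] [MeasurableSpace C] [BorelSpace C] {E : Set (X × C)} (hE : MeasurableSet E)
    (hcomp : ∀ x, IsCompact {b | (x, b) ∈ E}) : MeasurableSet {x | ∃ b, (x, b) ∈ E} := by
  let _ := upgradeStandardBorel X
  obtain ⟨U, hU⟩ := TopologicalSpace.exists_seq_basis C
  have hUo : ∀ n, IsOpen (U n) := fun n => hU.isOpen (mem_range_self n)
  set N : ℕ → Set X := fun n => Prod.fst '' (E ∩ univ ×ˢ U n) with hN
  have hNa : ∀ n, AnalyticSet (N n) := fun n =>
    (hE.inter (MeasurableSet.univ.prod (hUo n).measurableSet)).analyticSet_image measurable_fst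
  set D : ℕ → Set (X × C) := fun n => (fun p : (X × C) × C => (p.1.1, p.2)) ''
    {p | (p.1.1, p.2) ∈ Eᶜ ∧ (p.1 ∈ E ∧ p.1.2 ∈ U n ∨ p.2 ∈ (U n)ᶜ)} with hD
  have hDa : ∀ n, AnalyticSet (D n) := by
    intro n
    have hm : Measurable fun p : (X × C) × C => (p.1.1, p.2) := by fun_prop
    refine MeasurableSet.analyticSet_image ?_ hm
    exact (hm hE.compl).inter
      (((measurable_fst hE).inter ((measurable_snd.comp measurable_fst) (hUo n).measurableSet)).union
        (measurable_snd (hUo n).measurableSet.compl))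
  have hDe : ⋂ n, D n = ∅ := by
    refine eq_empty_of_subset_empty fun q hq => ?_
    rw [mem_iInter] at hq
    have hqE : q ∈ Eᶜ := by
      obtain ⟨p, hp, rfl⟩ := hq 0
      exact hp.1
    obtain ⟨_, ⟨n, rfl⟩, hqn, hsub⟩ := hU.exists_subset_of_mem_open
      (show q.2 ∈ {b | (q.1, b) ∈ E}ᶜ from hqE) (hcomp q.1).isClosed.isOpen_compl
    obtain ⟨p, hp, rfl⟩ := hq n
    rcases hp.2 with h | h
    · exact hsub h.2 h.1
    · exact h hqn
  obtain ⟨H, hDH, hHm, hHe⟩ := exists_measurable_superset_iInter_eq_empty hDa hDe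
  have hW : ∀ n x b, (x, b) ∈ Eᶜ \ H n → b ∈ U n ∧ x ∉ N n := by
    intro n x b hxb
    have hnD : (x, b) ∉ D n := fun h => hxb.2 (hDH n h)
    refine ⟨by_contra fun h => hnD ⟨((x, b), b), ⟨hxb.1, Or.inr h⟩, rfl⟩, ?_⟩
    rintro ⟨⟨x', b'⟩, ⟨hE', hU'⟩, rfl⟩
    exact hnD ⟨((x', b'), b), ⟨hxb.1, Or.inl ⟨hE', hU'.2⟩⟩, rfl⟩
  have hsep : ∀ n, MeasurablySeparable (Prod.fst '' (Eᶜ \ H n)) (N n) := by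
    intro n
    refine AnalyticSet.measurablySeparable
      ((hE.compl.diff (hHm n)).analyticSet_image measurable_fst) (hNa n) ?_
    rw [disjoint_left]
    rintro _ ⟨⟨x, b⟩, hxb, rfl⟩
    exact (hW n x b hxb).2
  choose B hB1 hB2 hB3 using hsep
  have hcompl : {x | ∃ b, (x, b) ∈ E}ᶜ =
      ⋃ F : {F : Finset ℕ // ⋃ n ∈ F, U n = univ}, ⋂ n ∈ F.1, B n := by
    ext x
    simp only [mem_compl_iff, mem_ofPred_eq, not_exists, mem_iUnion, mem_iInter]
    constructor
    · intro hx
      have hcov : (univ : Set C) ⊆ ⋃ n : {n // x ∈ B n}, U n := by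
        intro b _
        have : ∃ n, (x, b) ∉ H n := by
          by_contra! hall
          have : (x, b) ∈ ⋂ n, H n := mem_iInter.2 hall
          rw [hHe] at this
          exact this
        obtain ⟨n, hn⟩ := this
        exact mem_iUnion.2 ⟨⟨n, hB1 n ⟨(x, b), ⟨hx b, hn⟩, rfl⟩⟩, (hW n x b ⟨hx b, hn⟩).1⟩
      obtain ⟨t, ht⟩ := isCompact_univ.elim_finite_subcover _
        (fun n : {n // x ∈ B n} => hUo n.1) hcov
      refine ⟨⟨t.map (Function.Embedding.subtype _), ?_⟩, ?_⟩
      · refine eq_univ_of_univ_subset (ht.trans (iUnion₂_subset fun n hn => ?_))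
        exact subset_biUnion_of_mem (u := fun n => U n) (Finset.mem_map_of_mem _ hn)
      · intro n hn
        simp only [Finset.mem_map, Function.Embedding.subtype_apply] at hn
        obtain ⟨m, -, rfl⟩ := hn
        exact m.2
    · rintro ⟨⟨F, hF⟩, hx⟩ b hb
      have : b ∈ ⋃ n ∈ F, U n := hF ▸ mem_univ b
      simp only [mem_iUnion] at this
      obtain ⟨n, hn, hbn⟩ := this
      exact disjoint_left.1 (hB2 n) ⟨(x, b), ⟨hb, mem_univ _, hbn⟩, rfl⟩ (hx n hn)
  rw [← compl_compl {x | ∃ b, (x, b) ∈ E}, hcompl]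
  exact (MeasurableSet.iUnion fun F => Finset.measurableSet_biInter _ fun n _ => hB3 n).compl

/-- The projection of a measurable set with compact sections is measurable. -/
theorem measurableSet_fst_image_of_isCompact_sections {X A : Type*}
    [MeasurableSpace X] [StandardBorelSpace X] [MetricSpace A] [TopologicalSpace.SeparableSpace A]
    [MeasurableSpace A] [BorelSpace A] [StandardBorelSpace A] {E : Set (X × A)}
    (hE : MeasurableSet E) (hcomp : ∀ x, IsCompact {b | (x, b) ∈ E}) :
    MeasurableSet {x | ∃ b, (x, b) ∈ E} := by
  cases isEmpty_or_nonempty A with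
  | inl h => simp
  | inr h =>
  let ι : A → ℕ → Icc (0 : ℝ) 1 := fun b n =>
    projIcc 0 1 zero_le_one (dist b (TopologicalSpace.denseSeq A n))
  have hιc : Continuous ι := by
    refine continuous_pi fun n => continuous_projIcc.comp ?_
    fun_prop
  have hιi : Function.Injective ι := by
    intro b b' hbb
    by_contra hne
    set r := min (dist b b') 1 with hr
    have hr0 : 0 < r := lt_min (dist_pos.2 hne) one_pos
    obtain ⟨n, hn⟩ := (TopologicalSpace.denseRange_denseSeq A).exists_dist_lt b (half_pos hr0)
    have h1 : dist b (TopologicalSpace.denseSeq A n) < 1 := by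
      linarith [min_le_right (dist b b') 1]
    have h2 := congrArg Subtype.val (congrFun hbb n)
    simp only [ι, coe_projIcc] at h2
    have hpos : 0 ≤ dist b (TopologicalSpace.denseSeq A n) := dist_nonneg
    have hpos' : 0 ≤ dist b' (TopologicalSpace.denseSeq A n) := dist_nonneg
    rw [min_eq_right h1.le, max_eq_right hpos, max_eq_right (le_min zero_le_one hpos')] at h2
    have h3 : dist b' (TopologicalSpace.denseSeq A n) < r / 2 := by
      rcases min_choice 1 (dist b' (TopologicalSpace.denseSeq A n)) with h | h <;> rw [h] at h2
      · linarith
      · rw [← h2]; exact hn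
    have := dist_triangle_right b b' (TopologicalSpace.denseSeq A n)
    linarith [min_le_left (dist b b') 1]
  have hinj : Function.Injective (Prod.map id ι : X × A → X × (ℕ → Icc (0 : ℝ) 1)) :=
    Function.injective_id.prodMap hιi
  have hmeas : MeasurableSet (Prod.map id ι '' E) :=
    hE.image_of_measurable_injOn (measurable_id.prodMap hιc.measurable) hinj.injOn
  have hsec : ∀ x, {z | (x, z) ∈ Prod.map id ι '' E} = ι '' {b | (x, b) ∈ E} := by
    intro x
    ext z
    simp
  have := measurableSet_fst_image_of_isCompact_sections_of_compactSpace hmeas fun x => by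
    rw [hsec x]; exact (hcomp x).image hιc
  convert this using 1
  ext x
  simp

/-- An extended nonnegative function is inf-compact if its finite sublevel sets are compact. -/
def InfCompact {B : Type*} [TopologicalSpace B] (g : B → ℝ≥0∞) : Prop :=
  ∀ r : ℝ≥0∞, r ≠ ⊤ → IsCompact {b | g b ≤ r}

theorem InfCompact.lowerSemicontinuous {B : Type*} [TopologicalSpace B] [T2Space B]
    {g : B → ℝ≥0∞} (hg : InfCompact g) : LowerSemicontinuous g := by
  rw [lowerSemicontinuous_iff_isClosed_preimage]
  intro r
  by_cases hr : r = ⊤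
  · simp [hr]
  · exact (hg r hr).isClosed

theorem InfCompact.mono {B : Type*} [TopologicalSpace B] {g h : B → ℝ≥0∞} (hg : InfCompact g)
    (hle : g ≤ h) (hh : LowerSemicontinuous h) : InfCompact h := fun r hr =>
  (hg r hr).of_isClosed_subset (hh.isClosed_preimage r) fun b hb => (hle b).trans hb

theorem InfCompact.add {B : Type*} [TopologicalSpace B] [T2Space B] {g h : B → ℝ≥0∞}
    (hg : InfCompact g) (hh : LowerSemicontinuous h) : InfCompact fun b => g b + h b :=
  hg.mono (fun _ => le_self_add) (hg.lowerSemicontinuous.add hh)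

theorem InfCompact.exists_eq_iInf {B : Type*} [TopologicalSpace B] [T2Space B] [Nonempty B]
    {g : B → ℝ≥0∞} (hg : InfCompact g) : ∃ b, g b = ⨅ b, g b := by
  by_cases htop : ⨅ b, g b = ⊤
  · obtain ⟨b⟩ := ‹Nonempty B›
    exact ⟨b, by rw [htop]; exact top_unique (htop ▸ iInf_le g b)⟩
  · obtain ⟨b₀, hb₀⟩ := iInf_lt_iff.1 (lt_top_iff_ne_top.2 htop)
    obtain ⟨b, -, hmin⟩ := (hg.lowerSemicontinuous.lowerSemicontinuousOn _).exists_isMinOn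
      (show {b | g b ≤ g b₀}.Nonempty from ⟨b₀, le_refl (g b₀)⟩) (hg _ hb₀.ne)
    refine ⟨b, le_antisymm (le_iInf fun b' => ?_) (iInf_le g b)⟩
    rcases le_total (g b') (g b₀) with h | h
    · exact hmin h
    · exact (hmin (show b₀ ∈ {b | g b ≤ g b₀} from le_refl (g b₀))).trans h

/-- For a monotone sequence of inf-compact functions, infimum and supremum commute. -/
theorem iInf_iSup_eq_of_monotone_of_infCompact {B : Type*} [TopologicalSpace B] [T2Space B]
    [Nonempty B] {g : ℕ → B → ℝ≥0∞} (hg : ∀ n, InfCompact (g n)) (hmono : Monotone g) :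
    ⨅ b, ⨆ n, g n b = ⨆ n, ⨅ b, g n b := by
  refine le_antisymm ?_ (iSup_iInf_le_iInf_iSup _)
  set s := ⨆ n, ⨅ b, g n b with hs
  by_cases htop : s = ⊤
  · rw [htop]; exact le_top
  have hne : (⋂ n, {b | g n b ≤ s}).Nonempty := by
    refine IsCompact.nonempty_iInter_of_sequence_nonempty_isCompact_isClosed _
      (fun n b hb => (hmono n.le_succ b).trans hb) (fun n => ?_) (hg 0 s htop)
      fun n => (hg n s htop).isClosed
    obtain ⟨b, hb⟩ := (hg n).exists_eq_iInf
    exact ⟨b, hb.le.trans (le_iSup (fun n => ⨅ b, g n b) n)⟩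
  obtain ⟨b, hb⟩ := hne
  exact iInf_le_of_le b (iSup_le fun n => mem_iInter.1 hb n)

section Selection

variable {X A : Type*} [MeasurableSpace X] [StandardBorelSpace X] [MetricSpace A]
  [TopologicalSpace.SeparableSpace A] [MeasurableSpace A] [BorelSpace A] [StandardBorelSpace A]

/-- A measurable set with nonempty compact sections admits a measurable selector. -/
theorem exists_measurable_selector {E : Set (X × A)}
    (hE : MeasurableSet E) (hcomp : ∀ x, IsCompact {b | (x, b) ∈ E})
    (hne : ∀ x, ∃ b, (x, b) ∈ E) : ∃ φ : X → A, Measurable φ ∧ ∀ x, (x, φ x) ∈ E := by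
  classical
  cases isEmpty_or_nonempty X with
  | inl h => exact ⟨fun x => (h.false x).elim, measurable_of_empty _, fun x => (h.false x).elim⟩
  | inr h =>
  have hA : Nonempty A := ⟨(hne h.some).choose⟩
  set d := TopologicalSpace.denseSeq A with hd
  -- one refinement step, replacing sections by their intersections with a small closed ball
  have step : ∀ (G : Set (X × A)) (r : ℝ), 0 < r → MeasurableSet G →
      (∀ x, IsCompact {b | (x, b) ∈ G}) → (∀ x, ∃ b, (x, b) ∈ G) →
      ∃ i : X → ℕ, Measurable i ∧ ∀ x, ∃ b, (x, b) ∈ G ∧ dist b (d (i x)) ≤ r := by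
    intro G r hr hG hGc hGn
    have hex : ∀ x, ∃ n, ∃ b, (x, b) ∈ G ∧ dist b (d n) ≤ r := by
      intro x
      obtain ⟨b, hb⟩ := hGn x
      obtain ⟨n, hn⟩ := (TopologicalSpace.denseRange_denseSeq A).exists_dist_lt b hr
      exact ⟨n, b, hb, hn.le⟩
    refine ⟨fun x => Nat.find (hex x), measurable_find hex fun n => ?_,
      fun x => Nat.find_spec (hex x)⟩
    have hball : MeasurableSet {p : X × A | dist p.2 (d n) ≤ r} :=
      measurable_snd (Metric.isClosed_closedBall (x := d n) (ε := r)).measurableSet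
    exact measurableSet_fst_image_of_isCompact_sections (hG.inter hball) fun x =>
      (hGc x).inter_right (Metric.isClosed_closedBall (x := d n) (ε := r))
  let T := {G : Set (X × A) // MeasurableSet G ∧ (∀ x, IsCompact {b | (x, b) ∈ G}) ∧
    ∀ x, ∃ b, (x, b) ∈ G}
  have hr : ∀ n : ℕ, (0 : ℝ) < (1 / 2) ^ n := fun n => by positivity
  choose i him hi using fun (G : T) (n : ℕ) => step G.1 _ (hr n) G.2.1 G.2.2.1 G.2.2.2
  let next : ℕ → T → T := fun n G => ⟨G.1 ∩ {p | dist p.2 (d (i G n p.1)) ≤ (1 / 2) ^ n}, by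
    refine G.2.1.inter (measurableSet_le ?_ measurable_const)
    exact measurable_snd.dist ((measurable_from_nat (f := d)).comp ((him G n).comp measurable_fst)),
    fun x => (G.2.2.1 x).inter_right
      (Metric.isClosed_closedBall (x := d (i G n x)) (ε := (1 / 2) ^ n)), hi G n⟩
  let G : ℕ → T := fun n => Nat.rec ⟨E, hE, hcomp, hne⟩ next n
  have hGs : ∀ n, G (n + 1) = next n (G n) := fun _ => rfl
  have hsel : ∀ x, ∃ b, ∀ n, (x, b) ∈ (G n).1 := by
    intro x
    obtain ⟨b, hb⟩ := IsCompact.nonempty_iInter_of_sequence_nonempty_isCompact_isClosed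
      (fun n => {b | (x, b) ∈ (G n).1}) (fun n b hb => by
        have hb' : (x, b) ∈ (next n (G n)).1 := hb
        exact hb'.1) (fun n => (G n).2.2.2 x) ((G 0).2.2.1 x)
      fun n => ((G n).2.2.1 x).isClosed
    exact ⟨b, fun n => mem_iInter.1 hb n⟩
  choose φ hφ using hsel
  refine ⟨φ, ?_, fun x => hφ x 0⟩
  refine measurable_of_tendsto_metrizable (f := fun n x => d (i (G n) n x))
    (fun n => (measurable_from_nat (f := d)).comp (him (G n) n)) ?_
  rw [tendsto_pi_nhds]
  intro x
  rw [tendsto_iff_dist_tendsto_zero]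
  refine squeeze_zero (fun _ => dist_nonneg) (fun n => ?_)
    (tendsto_pow_atTop_nhds_zero_of_lt_one (r := (1 / 2 : ℝ)) (by norm_num) (by norm_num))
  have h : (x, φ x) ∈ (next n (G n)).1 := hφ x (n + 1)
  rw [dist_comm]
  exact h.2

/-- Partial minimization of a jointly measurable function that is inf-compact in the second
variable is measurable. -/
theorem measurable_iInf_of_infCompact {F : X × A → ℝ≥0∞} (hF : Measurable F)
    (hc : ∀ x, InfCompact fun b => F (x, b)) : Measurable fun x => ⨅ b, F (x, b) := by
  cases isEmpty_or_nonempty A with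
  | inl h => simp only [iInf_of_empty]; exact measurable_const
  | inr h =>
  refine measurable_of_Iic fun r => ?_
  by_cases hr : r = ⊤
  · simp [hr]
  · have hset : (fun x => ⨅ b, F (x, b)) ⁻¹' Iic r = {x | ∃ b, (x, b) ∈ {p | F p ≤ r}} := by
      ext x
      simp only [mem_preimage, mem_Iic, mem_ofPred_eq]
      constructor
      · intro hx
        obtain ⟨b, hb⟩ := (hc x).exists_eq_iInf
        exact ⟨b, hb.le.trans hx⟩
      · rintro ⟨b, hb⟩
        exact iInf_le_of_le b hb
    rw [hset]
    exact measurableSet_fst_image_of_isCompact_sections (measurableSet_le hF measurable_const)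
      fun x => hc x r hr

/-- A jointly measurable function that is inf-compact in the second variable admits a measurable
minimizer. -/
theorem exists_measurable_minimizer [Nonempty A] {F : X × A → ℝ≥0∞} (hF : Measurable F)
    (hc : ∀ x, InfCompact fun b => F (x, b)) :
    ∃ φ : X → A, Measurable φ ∧ ∀ x, F (x, φ x) = ⨅ b, F (x, b) := by
  set m : X → ℝ≥0∞ := fun x => ⨅ b, F (x, b) with hm
  have hmm : Measurable m := measurable_iInf_of_infCompact hF hc
  obtain ⟨b₀⟩ := ‹Nonempty A›
  have hmb : Measurable fun p : X × A => m p.1 := hmm.comp measurable_fst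
  set E : Set (X × A) := {p | (m p.1 ≠ ⊤ ∧ F p ≤ m p.1) ∨ (m p.1 = ⊤ ∧ p.2 = b₀)} with hE
  have hEm : MeasurableSet E :=
    (((hmb (measurableSet_singleton ⊤)).compl).inter (measurableSet_le hF hmb)).union
      ((hmb (measurableSet_singleton ⊤)).inter (measurable_snd (measurableSet_singleton b₀)))
  have hsec : ∀ x, IsCompact {b | (x, b) ∈ E} := by
    intro x
    by_cases hx : m x = ⊤
    · convert isCompact_singleton (x := b₀)
      ext b; simp [hE, hx]
    · convert hc x (m x) hx using 1
      ext b; simp [hE, hx]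
  have : Nonempty A := ⟨b₀⟩
  obtain ⟨φ, hφ, hφE⟩ := exists_measurable_selector hEm hsec fun x => by
    by_cases hx : m x = ⊤
    · exact ⟨b₀, Or.inr ⟨hx, rfl⟩⟩
    · obtain ⟨b, hb⟩ := (hc x).exists_eq_iInf
      exact ⟨b, Or.inl ⟨hx, hb.le⟩⟩
  refine ⟨φ, hφ, fun x => le_antisymm ?_ (iInf_le _ _)⟩
  rcases hφE x with h | h
  · exact h.2
  · exact le_top.trans h.1.ge

end Selection

section Trajectories

variable {X A : Type*} [MeasurableSpace X] [MeasurableSpace A]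

theorem measurable_histSnoc (t : ℕ) : Measurable fun z : (Hist X A t × A) × X =>
    ((Fin.snoc z.1.1.1 (z.1.1.2, z.1.2), z.2) : Hist X A (t + 1)) := by
  refine Measurable.prodMk (measurable_pi_lambda _ fun i => ?_) measurable_snd
  refine Fin.lastCases ?_ (fun j => ?_) i
  · simp only [Fin.snoc_last]; fun_prop
  · simp only [Fin.snoc_castSucc]; fun_prop

/-- The transition kernel from a history and an action to the extended history. -/
def histKernel (M : MDP X A) (t : ℕ) : Kernel (Hist X A t × A) (Hist X A (t + 1)) :=
  (Kernel.id ×ₖ (M.q.comap (fun z : Hist X A t × A => (z.1.2, z.2)) (by fun_prop))).map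
    fun z => (Fin.snoc z.1.1.1 (z.1.1.2, z.1.2), z.2)

theorem histKernel_apply (M : MDP X A) (t : ℕ) (h : Hist X A t) (b : A) :
    histKernel M t (h, b) = (M.q (h.2, b)).map fun x' =>
      ((Fin.snoc h.1 (h.2, b), x') : Hist X A (t + 1)) := by
  have := M.markov
  rw [histKernel, Kernel.map_apply _ (measurable_histSnoc t), Kernel.prod_apply, Kernel.id_apply,
    Kernel.comap_apply, Measure.dirac_prod,
    Measure.map_map (measurable_histSnoc t) measurable_prodMk_left]
  rfl

theorem measurable_bind_kernel {B C D : Type*} [MeasurableSpace B] [MeasurableSpace C]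
    [MeasurableSpace D] (κ : Kernel B C) [IsMarkovKernel κ] (η : Kernel (B × C) D) :
    Measurable fun b => (κ b).bind fun c => η (b, c) := by
  refine Measure.measurable_of_measurable_coe _ fun s hs => ?_
  have : ∀ b, ((κ b).bind fun c => η (b, c)) s = ∫⁻ c, η (b, c) s ∂κ b := fun b =>
    Measure.bind_apply hs (η.measurable.comp measurable_prodMk_left).aemeasurable
  simp_rw [this]
  exact (Kernel.measurable_coe η hs).lintegral_kernel_prod_right'

theorem lintegral_histMeas_zero (M : MDP X A) (p : Policy X A) (x : X) {f : X → ℝ≥0∞}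
    (hf : Measurable f) : ∫⁻ h, f h.2 ∂histMeas M p x 0 = f x :=
  lintegral_dirac' _ (hf.comp measurable_snd)

theorem lintegral_histMeas_succ (M : MDP X A) (p : Policy X A) (x : X) (t : ℕ)
    {f : Hist X A (t + 1) → ℝ≥0∞} (hf : Measurable f) :
    ∫⁻ h, f h ∂histMeas M p x (t + 1) =
      ∫⁻ h, ∫⁻ b, ∫⁻ x', f (Fin.snoc h.1 (h.2, b), x') ∂M.q (h.2, b) ∂p.π t h
        ∂histMeas M p x t := by
  have := p.markov t
  rw [histMeas]
  simp_rw [← histKernel_apply]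
  rw [Measure.lintegral_bind (measurable_bind_kernel _ _).aemeasurable hf.aemeasurable]
  refine lintegral_congr fun h => ?_
  refine (Measure.lintegral_bind
    ((histKernel M t).measurable.comp measurable_prodMk_left).aemeasurable hf.aemeasurable).trans ?_
  refine lintegral_congr fun b => ?_
  rw [Function.comp_apply, histKernel_apply, lintegral_map hf]
  exact (measurable_histSnoc t).comp (measurable_prodMk_left (x := (h, b)))

theorem measurable_map_histAction (p : Policy X A) (t : ℕ) :
    Measurable fun h : Hist X A t => (p.π t h).map fun b => (h.2, b) := by
  have := p.markov t
  convert measurable_bind_kernel (p.π t)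
    (Kernel.deterministic (fun z : Hist X A t × A => (z.1.2, z.2)) (by fun_prop)) using 2 with h
  simp only [Kernel.deterministic_apply]
  rw [Measure.bind_dirac_eq_map _ measurable_prodMk_left]

theorem lintegral_saMeas (M : MDP X A) (p : Policy X A) (x : X) (t : ℕ) {g : X × A → ℝ≥0∞}
    (hg : Measurable g) :
    ∫⁻ z, g z ∂saMeas M p x t = ∫⁻ h, ∫⁻ b, g (h.2, b) ∂p.π t h ∂histMeas M p x t := by
  rw [saMeas, Measure.lintegral_bind (measurable_map_histAction p t).aemeasurable hg.aemeasurable]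
  refine lintegral_congr fun h => ?_
  rw [lintegral_map hg measurable_prodMk_left]

instance isProbabilityMeasure_histMeas (M : MDP X A) (p : Policy X A) (x : X) (t : ℕ) :
    IsProbabilityMeasure (histMeas M p x t) := by
  have := M.markov
  have := p.markov
  induction t with
  | zero => rw [histMeas]; infer_instance
  | succ t ih =>
    constructor
    have := lintegral_histMeas_succ M p x t (f := fun _ => 1) measurable_const
    simpa using this

instance isProbabilityMeasure_saMeas (M : MDP X A) (p : Policy X A) (x : X) (t : ℕ) :
    IsProbabilityMeasure (saMeas M p x t) := by
  have := p.markov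
  constructor
  have := lintegral_saMeas M p x t (g := fun _ => 1) measurable_const
  simpa using this

theorem lintegral_histMeas_succ_snd (M : MDP X A) (p : Policy X A) (x : X) (t : ℕ)
    {f : X → ℝ≥0∞} (hf : Measurable f) :
    ∫⁻ h, f h.2 ∂histMeas M p x (t + 1) = ∫⁻ z, ∫⁻ y, f y ∂M.q z ∂saMeas M p x t := by
  rw [lintegral_histMeas_succ M p x t (f := fun h => f h.2) (hf.comp measurable_snd),
    lintegral_saMeas M p x t (hf.lintegral_kernel)]

theorem lintegral_saMeas_detPolicy (M : MDP X A) {φ : X → A} (hφ : Measurable φ) (x : X) (t : ℕ)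
    {g : X × A → ℝ≥0∞} (hg : Measurable g) :
    ∫⁻ z, g z ∂saMeas M (detPolicy φ hφ) x t =
      ∫⁻ h, g (h.2, φ h.2) ∂histMeas M (detPolicy φ hφ) x t := by
  rw [lintegral_saMeas _ _ _ _ hg]
  refine lintegral_congr fun h => ?_
  exact lintegral_dirac' _ (hg.comp measurable_prodMk_left)

end Trajectories

theorem eToENN_coe_sub_add (P : ℝ≥0∞) (k : ℝ≥0) :
    eToENN ((P : EReal) - ((k : ℝ) : EReal)) + k =
      P + eToENN (-((P : EReal) - ((k : ℝ) : EReal))) := by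
  induction P with
  | top =>
    have h : ((⊤ : ℝ≥0∞) : EReal) - ((k : ℝ) : EReal) = ⊤ := EReal.top_sub_coe _
    rw [h]
    simp [eToENN]
  | coe P =>
    have h : (((P : ℝ≥0∞) : EReal) - ((k : ℝ) : EReal)) = ((P - k : ℝ) : EReal) := rfl
    rw [h, ← EReal.coe_neg]
    simp only [eToENN, EReal.coe_ne_top, if_false, EReal.toReal_coe]
    rcases le_total (P : ℝ) k with hle | hle
    · rw [ENNReal.ofReal_of_nonpos (by linarith), zero_add]
      rw [← ENNReal.ofReal_coe_nnreal (p := k), ← ENNReal.ofReal_coe_nnreal (p := P),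
        ← ENNReal.ofReal_add (by positivity) (by linarith)]
      congr 1; ring
    · rw [ENNReal.ofReal_of_nonpos (p := -(P - k : ℝ)) (by linarith), add_zero]
      rw [← ENNReal.ofReal_coe_nnreal (p := k), ← ENNReal.ofReal_coe_nnreal (p := P),
        ← ENNReal.ofReal_add (by linarith) (by positivity)]
      congr 1; ring

theorem eToENN_coe (P : ℝ≥0∞) : eToENN (P : EReal) = P := EReal.toENNReal_coe

theorem eToENN_neg_coe (P : ℝ≥0∞) : eToENN (-(P : EReal)) = 0 :=
  EReal.toENNReal_of_nonpos (by simp [EReal.coe_ennreal_nonneg])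

theorem eInt_coe {Y : Type*} [MeasurableSpace Y] (μ : Measure Y) (P : Y → ℝ≥0∞) :
    eInt μ (fun y => (P y : EReal)) = ((∫⁻ y, P y ∂μ : ℝ≥0∞) : EReal) := by
  simp [eInt, eToENN_coe, eToENN_neg_coe]

theorem EReal.coe_ennreal_sub_coe_ennreal_eq {a b c d : ℝ≥0∞} (h : a + d = c + b) (hb : b ≠ ⊤)
    (hd : d ≠ ⊤) : (a : EReal) - (b : EReal) = (c : EReal) - (d : EReal) := by
  lift b to ℝ≥0 using hb
  lift d to ℝ≥0 using hd
  induction a with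
  | top =>
    have hc : c = ⊤ := by
      by_contra hc
      exact ENNReal.add_ne_top.2 ⟨hc, ENNReal.coe_ne_top⟩ (h.symm.trans (top_add _))
    rw [hc]
    exact (EReal.top_sub_coe _).trans (EReal.top_sub_coe _).symm
  | coe a =>
    have hc : c ≠ ⊤ := by
      rintro rfl
      rw [top_add] at h
      exact ENNReal.add_ne_top.2 ⟨ENNReal.coe_ne_top, ENNReal.coe_ne_top⟩ h
    lift c to ℝ≥0 using hc
    have h' : (a : ℝ) + d = c + b := by exact_mod_cast h
    change (((a : ℝ) - (b : ℝ) : ℝ) : EReal) = (((c : ℝ) - (d : ℝ) : ℝ) : EReal)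
    congr 1; linarith

theorem eInt_coe_sub {Y : Type*} [MeasurableSpace Y] (μ : Measure Y) {P : Y → ℝ≥0∞}
    (hP : Measurable P) {k : Y → ℝ≥0} (hk : Measurable k) (hfin : ∫⁻ y, k y ∂μ ≠ ⊤) :
    eInt μ (fun y => (P y : EReal) - ((k y : ℝ) : EReal)) =
      ((∫⁻ y, P y ∂μ : ℝ≥0∞) : EReal) - ((∫⁻ y, k y ∂μ : ℝ≥0∞) : EReal) := by
  have hkE : Measurable fun y => (k y : ℝ≥0∞) := hk.coe_nnreal_ennreal
  refine EReal.coe_ennreal_sub_coe_ennreal_eq ?_ ?_ hfin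
  · rw [← lintegral_add_right _ hkE, ← lintegral_add_left hP]
    exact lintegral_congr fun y => eToENN_coe_sub_add _ _
  · refine ne_top_of_le_ne_top hfin (lintegral_mono fun y => ?_)
    have : -((P y : EReal) - ((k y : ℝ) : EReal)) ≤ ((k y : ℝ≥0∞) : EReal) := by
      rw [EReal.neg_le]
      have h : -((k y : ℝ≥0∞) : EReal) = 0 - ((k y : ℝ) : EReal) := by rw [zero_sub]; rfl
      rw [h]
      exact EReal.sub_le_sub (EReal.coe_ennreal_nonneg _) le_rfl
    calc eToENN _ ≤ eToENN ((k y : ℝ≥0∞) : EReal) := EReal.toENNReal_le_toENNReal this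
      _ = k y := eToENN_coe _

theorem eSum_coe_sub {P : ℕ → ℝ≥0∞} {k : ℕ → ℝ≥0} (hfin : ∑' t, (k t : ℝ≥0∞) ≠ ⊤) :
    eSum (fun t => (P t : EReal) - ((k t : ℝ) : EReal)) =
      ((∑' t, P t : ℝ≥0∞) : EReal) - ((∑' t, (k t : ℝ≥0∞) : ℝ≥0∞) : EReal) := by
  have := eInt_coe_sub Measure.count (P := P) (k := k) (measurable_of_countable _)
    (measurable_of_countable _) (by rwa [lintegral_count])
  simpa only [eInt, eSum, lintegral_count] using this

theorem EReal.iInf_coe_ennreal_sub {ι : Sort*} (D : ι → ℝ≥0∞) (k : ℝ) :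
    ⨅ i, ((D i : EReal) - (k : EReal)) = ((⨅ i, D i : ℝ≥0∞) : EReal) - (k : EReal) := by
  refine le_antisymm ?_
    (le_iInf fun i => EReal.sub_le_sub (EReal.coe_ennreal_le_coe_ennreal_iff.2 (iInf_le D i)) le_rfl)
  rw [EReal.le_sub_iff_add_le (Or.inl (EReal.coe_ne_bot k)) (Or.inl (EReal.coe_ne_top k))]
  refine (le_max_right 0 _).trans (EReal.coe_toENNReal_eq_max.ge.trans
    (EReal.coe_ennreal_le_coe_ennreal_iff.2 (le_iInf fun i => ?_)))
  rw [← EReal.toENNReal_coe (x := D i)]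
  refine EReal.toENNReal_le_toENNReal ?_
  rw [← EReal.le_sub_iff_add_le (Or.inl (EReal.coe_ne_bot k)) (Or.inl (EReal.coe_ne_top k))]
  exact iInf_le _ i

theorem EReal.coe_mul_coe_ennreal_sub {r : ℝ} (hr : 0 ≤ r) (P : ℝ≥0∞) (k : ℝ) :
    (r : EReal) * ((P : EReal) - (k : EReal)) =
      ((ENNReal.ofReal r * P : ℝ≥0∞) : EReal) - ((r * k : ℝ) : EReal) := by
  rw [EReal.mul_sub_of_nonneg_of_ne_top (EReal.coe_nonneg.2 hr) (EReal.coe_ne_top r),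
    EReal.coe_ennreal_mul, EReal.coe_ennreal_ofReal, max_eq_left hr, EReal.coe_mul]

theorem EReal.coe_ennreal_sub_add_sub (P Q : ℝ≥0∞) (k l : ℝ) :
    ((P : EReal) - (k : EReal)) + ((Q : EReal) - (l : EReal)) =
      ((P + Q : ℝ≥0∞) : EReal) - ((k + l : ℝ) : EReal) := by
  rw [EReal.coe_ennreal_add, EReal.coe_add, EReal.add_sub_add_comm (by simp) (by simp)]

section Normalization

variable {X A : Type*} [MeasurableSpace X] [MeasurableSpace A]

/-- The one-step cost shifted by the constant `κ`. -/
def shiftCost (M : MDP X A) (κ : ℝ≥0) (z : X × A) : ℝ≥0∞ :=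
  (M.c z.1 z.2 + ((κ : ℝ) : EReal)).toENNReal

/-- The expected shifted cost at epoch `t`. -/
def stageCost (M : MDP X A) (κ : ℝ≥0) (p : Policy X A) (x : X) (t : ℕ) : ℝ≥0∞ :=
  ∫⁻ z, shiftCost M κ z ∂saMeas M p x t

/-- The discounted value function for the shifted cost. -/
def shiftValue (M : MDP X A) (κ : ℝ≥0) (β : ℝ≥0∞) (x : X) : ℝ≥0∞ :=
  ⨅ p : Policy X A, ∑' t, β ^ t * stageCost M κ p x t

theorem measurable_shiftCost (M : MDP X A) (κ : ℝ≥0) : Measurable (shiftCost M κ) :=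
  (M.c_meas.add_const _).ereal_toENNReal

variable {M : MDP X A} {κ : ℝ≥0}

theorem coe_shiftCost_sub (hκ : ∀ x b, ((-κ : ℝ) : EReal) ≤ M.c x b) (x : X) (b : A) :
    (shiftCost M κ (x, b) : EReal) - ((κ : ℝ) : EReal) = M.c x b := by
  rw [shiftCost, EReal.coe_toENNReal, EReal.add_sub_cancel_right]
  have := add_le_add_left (hκ x b) ((κ : ℝ) : EReal)
  rwa [← EReal.coe_add, neg_add_cancel] at this

theorem expCost_eq (hκ : ∀ x b, ((-κ : ℝ) : EReal) ≤ M.c x b) (p : Policy X A) (x : X) (t : ℕ) :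
    expCost M p x t = (stageCost M κ p x t : EReal) - ((κ : ℝ) : EReal) := by
  have h := eInt_coe_sub (saMeas M p x t) (measurable_shiftCost M κ) (k := fun _ => κ)
    measurable_const (by simp)
  simp only [lintegral_const, measure_univ, mul_one] at h
  rw [expCost, ← show _ = _ from funext fun z : X × A => coe_shiftCost_sub hκ z.1 z.2]
  exact h

theorem vFin_eq (hκ : ∀ x b, ((-κ : ℝ) : EReal) ≤ M.c x b) (p : Policy X A) (x : X) (N : ℕ) :
    vFin M N p x = ((∑ t ∈ Finset.range N, stageCost M κ p x t : ℝ≥0∞) : EReal) -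
      ((N * κ : ℝ) : EReal) := by
  induction N with
  | zero => simp [vFin]
  | succ N ih =>
    rw [vFin, Finset.sum_range_succ, ← vFin, ih, expCost_eq hκ, EReal.coe_ennreal_sub_add_sub,
      Finset.sum_range_succ]
    congr 3
    push_cast
    ring

theorem vDisc_eq (hκ : ∀ x b, ((-κ : ℝ) : EReal) ≤ M.c x b) {α : ℝ} (hα : α ∈ Ico (0 : ℝ) 1)
    (p : Policy X A) (x : X) :
    vDisc M α p x = ((∑' t, ENNReal.ofReal α ^ t * stageCost M κ p x t : ℝ≥0∞) : EReal) -
      (((1 - α)⁻¹ * κ : ℝ) : EReal) := by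
  have hk : ∑' t : ℕ, ((Real.toNNReal (α ^ t * κ) : ℝ≥0) : ℝ≥0∞) =
      ENNReal.ofReal ((1 - α)⁻¹ * κ) := by
    have hs : HasSum (fun t : ℕ => α ^ t * (κ : ℝ)) ((1 - α)⁻¹ * κ) :=
      (hasSum_geometric_of_lt_one hα.1 hα.2).mul_right _
    have h := ENNReal.ofReal_tsum_of_nonneg
      (fun t => mul_nonneg (pow_nonneg hα.1 t) κ.coe_nonneg) hs.summable
    rw [hs.tsum_eq] at h
    exact h.symm
  have h := eSum_coe_sub (P := fun t => ENNReal.ofReal α ^ t * stageCost M κ p x t)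
    (k := fun t => Real.toNNReal (α ^ t * κ)) (by rw [hk]; exact ENNReal.ofReal_ne_top)
  have hnonneg : 0 ≤ (1 - α)⁻¹ * (κ : ℝ) := mul_nonneg (inv_nonneg.2 (by linarith [hα.2])) κ.coe_nonneg
  rw [hk, EReal.coe_ennreal_ofReal, max_eq_left hnonneg] at h
  rw [vDisc, ← h]
  congr 1
  funext t
  rw [expCost_eq hκ, EReal.coe_mul_coe_ennreal_sub (pow_nonneg hα.1 t), ENNReal.ofReal_pow hα.1,
    Real.coe_toNNReal _ (mul_nonneg (pow_nonneg hα.1 t) κ.coe_nonneg)]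

theorem vDiscOpt_eq (hκ : ∀ x b, ((-κ : ℝ) : EReal) ≤ M.c x b) {α : ℝ} (hα : α ∈ Ico (0 : ℝ) 1)
    (x : X) : vDiscOpt M α x = (shiftValue M κ (ENNReal.ofReal α) x : EReal) -
      (((1 - α)⁻¹ * κ : ℝ) : EReal) := by
  simp only [vDiscOpt, vDisc_eq hκ hα, shiftValue, EReal.iInf_coe_ennreal_sub]

theorem mDisc_eq (hκ : ∀ x b, ((-κ : ℝ) : EReal) ≤ M.c x b) {α : ℝ} (hα : α ∈ Ico (0 : ℝ) 1) :
    mDisc M α = ((⨅ x, shiftValue M κ (ENNReal.ofReal α) x : ℝ≥0∞) : EReal) -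
      (((1 - α)⁻¹ * κ : ℝ) : EReal) := by
  simp only [mDisc, vDiscOpt_eq hκ hα, EReal.iInf_coe_ennreal_sub]

theorem one_sub_mul_mDisc_eq (hκ : ∀ x b, ((-κ : ℝ) : EReal) ≤ M.c x b) {α : ℝ}
    (hα : α ∈ Ico (0 : ℝ) 1) : ((1 - α : ℝ) : EReal) * mDisc M α =
      (((1 - ENNReal.ofReal α) * ⨅ x, shiftValue M κ (ENNReal.ofReal α) x : ℝ≥0∞) : EReal) -
        ((κ : ℝ) : EReal) := by
  have h1 : 0 < 1 - α := by linarith [hα.2]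
  rw [mDisc_eq hκ hα, EReal.coe_mul_coe_ennreal_sub h1.le, mul_inv_cancel_left₀ h1.ne',
    ENNReal.ofReal_sub _ hα.1, ENNReal.ofReal_one]

theorem uDisc_eq (hκ : ∀ x b, ((-κ : ℝ) : EReal) ≤ M.c x b) {α : ℝ} (hα : α ∈ Ico (0 : ℝ) 1)
    (hm : ⨅ x, shiftValue M κ (ENNReal.ofReal α) x ≠ ⊤) (x : X) :
    uDisc M α x = ((shiftValue M κ (ENNReal.ofReal α) x -
      ⨅ x, shiftValue M κ (ENNReal.ofReal α) x : ℝ≥0∞) : EReal) := by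
  rw [uDisc, vDiscOpt_eq hκ hα, mDisc_eq hκ hα, ENNReal.toEReal_sub hm (iInf_le _ x)]
  lift (⨅ x, shiftValue M κ (ENNReal.ofReal α) x) to ℝ≥0 using hm with m
  induction shiftValue M κ (ENNReal.ofReal α) x with
  | top => rfl
  | coe v =>
    change (((v : ℝ) - _ - ((m : ℝ) - _) : ℝ) : EReal) = (((v : ℝ) - (m : ℝ) : ℝ) : EReal)
    congr 1; ring

end Normalization

section Dynamics

variable {X A : Type*} [MeasurableSpace X] [MeasurableSpace A] {M : MDP X A} {κ : ℝ≥0} {β : ℝ≥0∞}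

theorem lintegral_histMeas_le_stageCost_add {f g : X → ℝ≥0∞} (hf : Measurable f)
    (hg : Measurable g) (hfg : ∀ x b, f x ≤ shiftCost M κ (x, b) + β * ∫⁻ y, g y ∂M.q (x, b))
    (p : Policy X A) (x : X) (t : ℕ) :
    ∫⁻ h, f h.2 ∂histMeas M p x t ≤
      stageCost M κ p x t + β * ∫⁻ h, g h.2 ∂histMeas M p x (t + 1) := by
  have := p.markov t
  have hf' : ∫⁻ h, f h.2 ∂histMeas M p x t = ∫⁻ z, f z.1 ∂saMeas M p x t := by
    rw [lintegral_saMeas M p x t (g := fun z => f z.1) (hf.comp measurable_fst)]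
    simp
  rw [hf', lintegral_histMeas_succ_snd M p x t hg, stageCost,
    ← lintegral_const_mul _ hg.lintegral_kernel, ← lintegral_add_left (measurable_shiftCost M κ)]
  exact lintegral_mono fun z => hfg z.1 z.2

theorem stageCost_add_le_lintegral_histMeas {f g : X → ℝ≥0∞} (hg : Measurable g) {φ : X → A}
    (hφ : Measurable φ)
    (hfg : ∀ x, shiftCost M κ (x, φ x) + β * ∫⁻ y, g y ∂M.q (x, φ x) ≤ f x) (x : X) (t : ℕ) :
    stageCost M κ (detPolicy φ hφ) x t +
        β * ∫⁻ h, g h.2 ∂histMeas M (detPolicy φ hφ) x (t + 1) ≤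
      ∫⁻ h, f h.2 ∂histMeas M (detPolicy φ hφ) x t := by
  have hm : Measurable fun z => shiftCost M κ z + β * ∫⁻ y, g y ∂M.q z :=
    (measurable_shiftCost M κ).add (hg.lintegral_kernel.const_mul _)
  rw [lintegral_histMeas_succ_snd M _ x t hg, stageCost,
    ← lintegral_const_mul _ hg.lintegral_kernel, ← lintegral_add_left (measurable_shiftCost M κ),
    lintegral_saMeas_detPolicy M hφ x t hm]
  exact lintegral_mono fun h => hfg h.2

theorem sum_stageCost_add_le {f : X → ℝ≥0∞} (hf : Measurable f) {φ : X → A}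
    (hφ : Measurable φ) {d : ℝ≥0∞}
    (hle : ∀ x, shiftCost M κ (x, φ x) + β * ∫⁻ y, f y ∂M.q (x, φ x) ≤ d + f x) (x : X) (N : ℕ) :
    ∑ t ∈ Finset.range N, β ^ t * stageCost M κ (detPolicy φ hφ) x t +
        β ^ N * ∫⁻ h, f h.2 ∂histMeas M (detPolicy φ hφ) x N ≤
      (∑ t ∈ Finset.range N, β ^ t) * d + f x := by
  induction N with
  | zero => simp [lintegral_histMeas_zero M _ x hf]
  | succ N ih =>
    have h := stageCost_add_le_lintegral_histMeas hf hφ hle x N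
    rw [lintegral_add_left measurable_const] at h
    simp only [lintegral_const, measure_univ, mul_one] at h
    calc _ = ∑ t ∈ Finset.range N, β ^ t * stageCost M κ (detPolicy φ hφ) x t +
          β ^ N * (stageCost M κ (detPolicy φ hφ) x N +
            β * ∫⁻ h, f h.2 ∂histMeas M (detPolicy φ hφ) x (N + 1)) := by
          rw [Finset.sum_range_succ, pow_succ]; ring
      _ ≤ ∑ t ∈ Finset.range N, β ^ t * stageCost M κ (detPolicy φ hφ) x t +
          β ^ N * (d + ∫⁻ h, f h.2 ∂histMeas M (detPolicy φ hφ) x N) := by gcongr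
      _ = β ^ N * d + (∑ t ∈ Finset.range N, β ^ t * stageCost M κ (detPolicy φ hφ) x t +
          β ^ N * ∫⁻ h, f h.2 ∂histMeas M (detPolicy φ hφ) x N) := by ring
      _ ≤ β ^ N * d + ((∑ t ∈ Finset.range N, β ^ t) * d + f x) := by gcongr
      _ = _ := by rw [Finset.sum_range_succ]; ring

/-- The dynamic programming operator for the shifted cost. -/
def bellman (M : MDP X A) (κ : ℝ≥0) (β : ℝ≥0∞) (f : X → ℝ≥0∞) (x : X) : ℝ≥0∞ :=
  ⨅ b, (shiftCost M κ (x, b) + β * ∫⁻ y, f y ∂M.q (x, b))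

theorem bellman_mono {f g : X → ℝ≥0∞} (h : f ≤ g) : bellman M κ β f ≤ bellman M κ β g :=
  fun _ => iInf_mono fun _ => add_le_add_right (mul_le_mul_right (lintegral_mono h) _) _

theorem monotone_bellman_iterate : Monotone fun n => (bellman M κ β)^[n] 0 :=
  Monotone.monotone_iterate_of_le_map (fun _ _ h => bellman_mono h) fun _ => zero_le

theorem bellman_iterate_le_sum_stageCost (hm : ∀ n, Measurable ((bellman M κ β)^[n] 0))
    (p : Policy X A) (x : X) (N k : ℕ) :
    ∫⁻ h, (bellman M κ β)^[N] 0 h.2 ∂histMeas M p x k ≤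
      ∑ t ∈ Finset.range N, β ^ t * stageCost M κ p x (k + t) := by
  induction N generalizing k with
  | zero => simp
  | succ N ih =>
    refine (lintegral_histMeas_le_stageCost_add (κ := κ) (β := β) (hm (N + 1)) (hm N) (fun x b => ?_) p x k).trans ?_
    · rw [Function.iterate_succ_apply']
      exact iInf_le _ b
    · rw [Finset.sum_range_succ']
      calc _ ≤ stageCost M κ p x k +
            β * ∑ t ∈ Finset.range N, β ^ t * stageCost M κ p x (k + 1 + t) := by gcongr; exact ih _
        _ = _ := by
          rw [Finset.mul_sum, add_comm]
          simp only [pow_zero, one_mul, add_zero, pow_succ', mul_assoc, add_assoc, add_comm 1]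

end Dynamics

section ValueClass

variable {X A : Type*} [MeasurableSpace X] [TopologicalSpace A] [MeasurableSpace A]

/-- A class of value functions preserved by dynamic programming, for which the one-step
minimization problems have minimizers. -/
structure IsValueClass (M : MDP X A) (κ : ℝ≥0) (C : (X → ℝ≥0∞) → Prop) : Prop where
  zero : C 0
  measurable : ∀ f, C f → Measurable f
  lintegral : ∀ f, C f → ∀ x, LowerSemicontinuous fun b => ∫⁻ y, f y ∂M.q (x, b)
  bellman : ∀ f, C f → ∀ β : ℝ≥0∞, β ≠ ⊤ → C (bellman M κ β f)
  iSup : ∀ f : ℕ → X → ℝ≥0∞, (∀ n, C (f n)) → Monotone f → C (⨆ n, f n)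
  shiftCost : ∀ x, InfCompact fun b => shiftCost M κ (x, b)

variable {M : MDP X A} {κ : ℝ≥0} {C : (X → ℝ≥0∞) → Prop}

theorem LowerSemicontinuous.ennreal_const_mul {B : Type*} [TopologicalSpace B] {g : B → ℝ≥0∞}
    (hg : LowerSemicontinuous g) {β : ℝ≥0∞} (hβ : β ≠ ⊤) :
    LowerSemicontinuous fun b => β * g b :=
  (ENNReal.continuous_const_mul hβ).comp_lowerSemicontinuous hg fun _ _ h => mul_le_mul_right h _

theorem IsValueClass.infCompact [T2Space A] (hC : IsValueClass M κ C) {f : X → ℝ≥0∞} (hf : C f)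
    {β : ℝ≥0∞} (hβ : β ≠ ⊤) (x : X) :
    InfCompact fun b => _root_.shiftCost M κ (x, b) + β * ∫⁻ y, f y ∂M.q (x, b) :=
  (hC.shiftCost x).add ((hC.lintegral f hf x).ennreal_const_mul hβ)

theorem ENNReal.iSup_mul_iSup_of_monotone {f g : ℕ → ℝ≥0∞} (hf : Monotone f) (hg : Monotone g) :
    (⨆ n, f n) * ⨆ n, g n = ⨆ n, f n * g n := by
  rw [ENNReal.iSup_mul]
  simp_rw [ENNReal.mul_iSup]
  refine le_antisymm (iSup₂_le fun i j => ?_) (iSup_le fun n => le_iSup₂_of_le n n le_rfl)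
  exact le_iSup_of_le (max i j) (mul_le_mul' (hf (le_max_left i j)) (hg (le_max_right i j)))

theorem iInf_shiftCost_add_lintegral_iSup [T2Space A] [Nonempty A] (hC : IsValueClass M κ C)
    {f : ℕ → X → ℝ≥0∞} (hf : ∀ n, C (f n)) (hmono : Monotone f) {β : ℕ → ℝ≥0∞}
    (hβ : Monotone β) (hβ1 : ∀ n, β n ≠ ⊤) (x : X) :
    ⨅ b, (shiftCost M κ (x, b) + (⨆ n, β n) * ∫⁻ y, (⨆ n, f n) y ∂M.q (x, b)) =
      ⨆ n, ⨅ b, (shiftCost M κ (x, b) + β n * ∫⁻ y, f n y ∂M.q (x, b)) := by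
  have hI : ∀ b, Monotone fun n => ∫⁻ y, f n y ∂M.q (x, b) := fun b n m h =>
    lintegral_mono (hmono h)
  rw [← iInf_iSup_eq_of_monotone_of_infCompact
    (g := fun n b => shiftCost M κ (x, b) + β n * ∫⁻ y, f n y ∂M.q (x, b))
    (fun n => hC.infCompact (hf n) (hβ1 n) x)
    (fun n m h b => add_le_add_right (mul_le_mul' (hβ h) (hI b h)) _)]
  refine iInf_congr fun b => ?_
  rw [← ENNReal.add_iSup, ← ENNReal.iSup_mul_iSup_of_monotone hβ (hI b)]
  rw [← lintegral_iSup (fun n => hC.measurable _ (hf n)) hmono]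
  simp only [iSup_apply]

theorem IsValueClass.bellman_iterate (hC : IsValueClass M κ C) {β : ℝ≥0∞} (hβ : β ≠ ⊤) (n : ℕ) :
    C ((_root_.bellman M κ β)^[n] 0) := by
  induction n with
  | zero => exact hC.zero
  | succ n ih => rw [Function.iterate_succ_apply']; exact hC.bellman _ ih β hβ

theorem IsValueClass.bellman_iSup_iterate [T2Space A] [Nonempty A]
    (hC : IsValueClass M κ C) {β : ℝ≥0∞}
    (hβ : β ≠ ⊤) :
    _root_.bellman M κ β (⨆ n, (_root_.bellman M κ β)^[n] 0) =
      ⨆ n, (_root_.bellman M κ β)^[n] 0 := by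
  funext x
  have h := iInf_shiftCost_add_lintegral_iSup hC (f := fun n => (_root_.bellman M κ β)^[n] 0)
    (hC.bellman_iterate hβ) monotone_bellman_iterate (β := fun _ => β) monotone_const (fun _ => hβ) x
  rw [ciSup_const] at h
  refine h.trans ?_
  rw [← monotone_bellman_iterate.iSup_nat_add 1, iSup_apply]
  simp only [Function.iterate_succ_apply']
  rfl

end ValueClass

section Discounted

variable {X A : Type*} [MeasurableSpace X] [StandardBorelSpace X] [MetricSpace A]
  [TopologicalSpace.SeparableSpace A]
  [MeasurableSpace A] [BorelSpace A] [StandardBorelSpace A] [Nonempty A]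
  {M : MDP X A} {κ : ℝ≥0} {C : (X → ℝ≥0∞) → Prop} {β : ℝ≥0∞}

theorem IsValueClass.exists_measurable_minimizer (hC : IsValueClass M κ C) {f : X → ℝ≥0∞}
    (hf : C f) (hβ : β ≠ ⊤) : ∃ φ : X → A, Measurable φ ∧ ∀ x,
      _root_.shiftCost M κ (x, φ x) + β * ∫⁻ y, f y ∂M.q (x, φ x) = _root_.bellman M κ β f x :=
  _root_.exists_measurable_minimizer
    (F := fun z => _root_.shiftCost M κ z + β * ∫⁻ y, f y ∂M.q z)
    ((measurable_shiftCost M κ).add ((hC.measurable f hf).lintegral_kernel.const_mul _))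
    (hC.infCompact hf hβ)

theorem IsValueClass.shiftValue_eq_iSup (hC : IsValueClass M κ C) (hβ : β ≠ ⊤) :
    shiftValue M κ β = ⨆ n, (_root_.bellman M κ β)^[n] 0 := by
  have hV : C (⨆ n, (_root_.bellman M κ β)^[n] 0) :=
    hC.iSup _ (hC.bellman_iterate hβ) monotone_bellman_iterate
  funext x
  apply le_antisymm
  · obtain ⟨φ, hφ, hmin⟩ := hC.exists_measurable_minimizer hV hβ
    rw [hC.bellman_iSup_iterate hβ] at hmin
    refine (iInf_le _ (detPolicy φ hφ)).trans ?_
    refine ENNReal.tsum_le_of_sum_range_le fun N => ?_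
    have h := sum_stageCost_add_le (hC.measurable _ hV) hφ (d := 0) (β := β) (κ := κ)
      (fun x => by rw [zero_add]; exact (hmin x).le) x N
    rw [mul_zero, zero_add] at h
    exact le_self_add.trans h
  · refine le_iInf fun p => ?_
    rw [iSup_apply]
    refine iSup_le fun N => ?_
    have h := bellman_iterate_le_sum_stageCost
      (fun n => hC.measurable _ (hC.bellman_iterate hβ n)) p x N 0
    rw [lintegral_histMeas_zero M p x (hC.measurable _ (hC.bellman_iterate hβ N))] at h
    simp only [zero_add] at h
    exact h.trans (ENNReal.sum_le_tsum _)

theorem IsValueClass.shiftValue_mem (hC : IsValueClass M κ C) (hβ : β ≠ ⊤) :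
    C (shiftValue M κ β) := by
  rw [hC.shiftValue_eq_iSup hβ]
  exact hC.iSup _ (hC.bellman_iterate hβ) monotone_bellman_iterate

theorem IsValueClass.bellman_shiftValue (hC : IsValueClass M κ C) (hβ : β ≠ ⊤) :
    _root_.bellman M κ β (shiftValue M κ β) = shiftValue M κ β := by
  rw [hC.shiftValue_eq_iSup hβ, hC.bellman_iSup_iterate hβ]

end Discounted

section AverageCost

theorem one_sub_mul_tsum_le {e : ℕ → ℝ≥0∞} {C r : ℝ≥0} {β : ℝ≥0∞} (hβ : β < 1)
    (h : ∀ N : ℕ, ∑ t ∈ Finset.range N, e t ≤ C + r * N) :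
    (1 - β) * ∑' t, β ^ t * e t ≤ (1 - β) * C + r := by
  choose s hs using fun N => exists_add_of_le (h N)
  have hfin : ∀ N, ∑ t ∈ Finset.range N, e t ≠ ⊤ := fun N =>
    ne_top_of_le_ne_top (by finiteness) (h N)
  have hstep : ∀ N, e N + s (N + 1) = r + s N := fun N => by
    refine (ENNReal.add_right_inj (hfin N)).1 ?_
    calc _ = ∑ t ∈ Finset.range (N + 1), e t + s (N + 1) := by rw [Finset.sum_range_succ]; ring
      _ = r + (C + r * N) := by rw [← hs]; push_cast; ring
      _ = _ := by rw [hs]; ring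
  have hsum : ∀ N, ∑ t ∈ Finset.range N, β ^ t * e t + β ^ N * s N ≤
      C + r * ∑ t ∈ Finset.range N, β ^ t := fun N => by
    induction N with
    | zero => have := hs 0; simp_all
    | succ N ih =>
      calc _ ≤ ∑ t ∈ Finset.range N, β ^ t * e t + β ^ N * (e N + s (N + 1)) := by
            rw [Finset.sum_range_succ, mul_add, add_assoc]
            gcongr _ + (_ + ?_ * _)
            exact pow_le_pow_right_of_le_one' hβ.le N.le_succ
        _ = (∑ t ∈ Finset.range N, β ^ t * e t + β ^ N * s N) + r * β ^ N := by
            rw [hstep]; ring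
        _ ≤ C + r * ∑ t ∈ Finset.range N, β ^ t + r * β ^ N := by gcongr
        _ = _ := by rw [Finset.sum_range_succ]; ring
  have htot : ∑' t, β ^ t * e t ≤ C + r * (1 - β)⁻¹ := by
    refine ENNReal.tsum_le_of_sum_range_le fun N => ?_
    refine le_self_add.trans ((hsum N).trans ?_)
    rw [← ENNReal.tsum_geometric]
    gcongr
    exact ENNReal.sum_le_tsum _
  calc _ ≤ (1 - β) * (C + r * (1 - β)⁻¹) := by gcongr
    _ = (1 - β) * C + r * ((1 - β) * (1 - β)⁻¹) := by ring
    _ ≤ (1 - β) * C + r * 1 := by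
      gcongr
      exact ENNReal.mul_inv_le_one _
    _ = _ := by rw [mul_one]

variable {X A : Type*} [MeasurableSpace X] [MeasurableSpace A] {M : MDP X A} {κ : ℝ≥0}

theorem inv_mul_vFin_eq (hκ : ∀ x b, ((-κ : ℝ) : EReal) ≤ M.c x b) (p : Policy X A) (x : X)
    {N : ℕ} (hN : 0 < N) : (((N : ℝ)⁻¹ : ℝ) : EReal) * vFin M N p x =
      (((N : ℝ≥0∞)⁻¹ * ∑ t ∈ Finset.range N, stageCost M κ p x t : ℝ≥0∞) : EReal) -
        ((κ : ℝ) : EReal) := by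
  have hN' : (0 : ℝ) < N := Nat.cast_pos.2 hN
  rw [vFin_eq hκ, EReal.coe_mul_coe_ennreal_sub (inv_nonneg.2 hN'.le),
    inv_mul_cancel_left₀ hN'.ne', ENNReal.ofReal_inv_of_pos hN', ENNReal.ofReal_natCast]

theorem EReal.coe_ennreal_sub_le_iff {P : ℝ≥0∞} {k : ℝ} {y : EReal} :
    (P : EReal) - (k : EReal) ≤ y ↔ (P : EReal) ≤ y + (k : EReal) :=
  EReal.sub_le_iff_le_add (Or.inl (EReal.coe_ne_bot k)) (Or.inl (EReal.coe_ne_top k))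

theorem neBot_nhdsWithin_Ico_one : (𝓝[Ico (0 : ℝ) 1] 1).NeBot :=
  mem_closure_iff_nhdsWithin_neBot.1 (by rw [closure_Ico zero_ne_one]; simp)

theorem wBar_le_avgCost (hκ : ∀ x b, ((-κ : ℝ) : EReal) ≤ M.c x b) (p : Policy X A) (x : X) :
    wBar M ≤ avgCost M p x := by
  refine EReal.le_of_forall_lt_iff_le.1 fun y hy => ?_
  obtain ⟨N₀, hN₀⟩ := eventually_atTop.1 (eventually_lt_of_limsup_lt hy)
  set S : ℕ → ℝ≥0∞ := fun N => ∑ t ∈ Finset.range N, stageCost M κ p x t with hS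
  have hb : ∀ N, max N₀ 1 ≤ N → S N ≤ ENNReal.ofReal (y + κ) * N := fun N hN => by
    have hpos : 0 < N := lt_of_lt_of_le one_pos ((le_max_right _ _).trans hN)
    have h := (hN₀ N ((le_max_left _ _).trans hN)).le
    rw [inv_mul_vFin_eq hκ p x hpos, EReal.coe_ennreal_sub_le_iff, ← EReal.coe_add] at h
    have h' := EReal.toENNReal_le_toENNReal h
    rw [EReal.toENNReal_coe, EReal.toENNReal_of_ne_top (EReal.coe_ne_top _),
      EReal.toReal_coe] at h'
    rw [mul_comm]
    exact (ENNReal.inv_mul_le_iff (by simp [hpos.ne']) (by simp)).1 h'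
  have hnn : 0 ≤ y + κ := by
    have h := (hN₀ (max N₀ 1) (le_max_left _ _)).le
    rw [inv_mul_vFin_eq hκ p x (by simp), EReal.coe_ennreal_sub_le_iff, ← EReal.coe_add] at h
    exact_mod_cast (EReal.coe_ennreal_nonneg _).trans h
  set r : ℝ≥0 := Real.toNNReal (y + κ) with hr
  have hr' : ENNReal.ofReal (y + κ) = r := rfl
  have hCfin : S (max N₀ 1) ≠ ⊤ := ne_top_of_le_ne_top (by finiteness) (hb _ le_rfl)
  lift S (max N₀ 1) to ℝ≥0 using hCfin with C hC
  have hbound : ∀ N, S N ≤ C + r * N := fun N => by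
    rcases le_total (max N₀ 1) N with h | h
    · exact (hb N h).trans le_add_self
    · rw [hC]
      exact (Finset.sum_le_sum_of_subset (Finset.range_mono h)).trans le_self_add
  have hle : ∀ᶠ α in 𝓝[Ico (0 : ℝ) 1] 1, ((1 - α : ℝ) : EReal) * mDisc M α ≤
      (((1 - α) * C + y : ℝ) : EReal) := by
    filter_upwards [self_mem_nhdsWithin] with α hα
    have h1 : 0 ≤ 1 - α := by linarith [hα.2]
    rw [one_sub_mul_mDisc_eq hκ hα, EReal.coe_ennreal_sub_le_iff, ← EReal.coe_add]
    have h := one_sub_mul_tsum_le (β := ENNReal.ofReal α) (by simpa using hα.2) hbound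
    have h2 : (1 - ENNReal.ofReal α) * ⨅ x, shiftValue M κ (ENNReal.ofReal α) x ≤
        ENNReal.ofReal ((1 - α) * C + y + κ) := by
      refine (mul_le_mul_right ((iInf_le _ x).trans (iInf_le _ p)) _).trans (h.trans_eq ?_)
      rw [← hr', add_assoc, ENNReal.ofReal_add (by positivity) hnn, ENNReal.ofReal_mul h1,
        ENNReal.ofReal_coe_nnreal, ENNReal.ofReal_sub _ hα.1, ENNReal.ofReal_one]
    refine (EReal.coe_ennreal_le_coe_ennreal_iff.2 h2).trans_eq ?_
    rw [EReal.coe_ennreal_ofReal, max_eq_left]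
    have : 0 ≤ (1 - α) * C := by positivity
    linarith
  have := neBot_nhdsWithin_Ico_one
  have hlim : Tendsto (fun α : ℝ => (((1 - α) * C + y : ℝ) : EReal)) (𝓝[Ico (0 : ℝ) 1] 1)
      (𝓝 (y : EReal)) := by
    refine (continuous_coe_real_ereal.tendsto y).comp (tendsto_nhdsWithin_of_tendsto_nhds ?_)
    have : Continuous fun α : ℝ => (1 - α) * C + y := by fun_prop
    simpa using this.tendsto 1
  exact (limsup_le_limsup hle).trans_eq hlim.limsup_eq

theorem wBar_le_wStar (hκ : ∀ x b, ((-κ : ℝ) : EReal) ≤ M.c x b) : wBar M ≤ wStar M :=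
  le_iInf fun x => le_iInf fun p => wBar_le_avgCost hκ p x

theorem wLow_le_wBar : wLow M ≤ wBar M := by
  have := neBot_nhdsWithin_Ico_one
  exact liminf_le_limsup

theorem neg_le_wLow (hκ : ∀ x b, ((-κ : ℝ) : EReal) ≤ M.c x b) :
    ((-κ : ℝ) : EReal) ≤ wLow M := by
  refine le_liminf_of_le (by isBoundedDefault) ?_
  filter_upwards [self_mem_nhdsWithin] with α hα
  rw [one_sub_mul_mDisc_eq hκ hα,
    EReal.le_sub_iff_add_le (Or.inl (EReal.coe_ne_bot _)) (Or.inl (EReal.coe_ne_top _)),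
    ← EReal.coe_add, neg_add_cancel]
  exact EReal.coe_ennreal_nonneg _

theorem avgCost_detPolicy_le (hκ : ∀ x b, ((-κ : ℝ) : EReal) ≤ M.c x b) {f : X → ℝ≥0}
    (hf : Measurable f) {φ : X → A} (hφ : Measurable φ) {d : ℝ≥0}
    (hle : ∀ x, shiftCost M κ (x, φ x) + ∫⁻ y, f y ∂M.q (x, φ x) ≤ d + f x) (x : X) :
    avgCost M (detPolicy φ hφ) x ≤ ((d - κ : ℝ) : EReal) := by
  have hS : ∀ N : ℕ, ∑ t ∈ Finset.range N, stageCost M κ (detPolicy φ hφ) x t ≤ N * d + f x := by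
    intro N
    have h := sum_stageCost_add_le (β := 1) hf.coe_nnreal_ennreal hφ
      (fun x => by rw [one_mul]; exact hle x) x N
    simp only [one_pow, one_mul, Finset.sum_const, Finset.card_range, nsmul_eq_mul, mul_one] at h
    exact le_self_add.trans h
  have hb : ∀ᶠ N : ℕ in atTop, (((N : ℝ)⁻¹ : ℝ) : EReal) * vFin M N (detPolicy φ hφ) x ≤
      ((d + (N : ℝ)⁻¹ * f x - κ : ℝ) : EReal) := by
    filter_upwards [eventually_gt_atTop 0] with N hN
    rw [inv_mul_vFin_eq hκ _ x hN, EReal.coe_ennreal_sub_le_iff, ← EReal.coe_add]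
    have h : (N : ℝ≥0∞)⁻¹ * ∑ t ∈ Finset.range N, stageCost M κ (detPolicy φ hφ) x t ≤
        ((d + (N : ℝ≥0)⁻¹ * f x : ℝ≥0) : ℝ≥0∞) := by
      refine (ENNReal.inv_mul_le_iff (by simp [hN.ne']) (by simp)).2 ((hS N).trans_eq ?_)
      have hN' : (N : ℝ≥0) ≠ 0 := by exact_mod_cast hN.ne'
      have : (N : ℝ≥0) * d + f x = N * (d + (N : ℝ≥0)⁻¹ * f x) := by field_simp
      exact_mod_cast this
    refine (EReal.coe_ennreal_le_coe_ennreal_iff.2 h).trans_eq ?_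
    rw [sub_add_cancel]
    rfl
  have hlim : Tendsto (fun N : ℕ => ((d + (N : ℝ)⁻¹ * f x - κ : ℝ) : EReal)) atTop
      (𝓝 ((d - κ : ℝ) : EReal)) := by
    refine (continuous_coe_real_ereal.tendsto _).comp ?_
    have := (((tendsto_inv_atTop_nhds_zero_nat (𝕜 := ℝ)).mul_const (f x : ℝ)).const_add
      (d : ℝ)).sub_const (κ : ℝ)
    simpa using this
  exact (limsup_le_limsup hb).trans_eq hlim.limsup_eq

end AverageCost

section LowerSemicontinuity

theorem lowerSemicontinuous_lintegral {Y P : Type*} [MeasurableSpace Y] [TopologicalSpace P]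
    [FirstCountableTopology P] (μ : P → Measure Y) {f : Y → ℝ≥0∞} (hf : Measurable f)
    (hμ : ∀ t, LowerSemicontinuous fun p => μ p {y | t < f y}) :
    LowerSemicontinuous fun p => ∫⁻ y, f y ∂μ p := by
  have hsup : ∀ p, ∫⁻ y, f y ∂μ p = ⨆ K : ℕ, ∫⁻ y, min (f y) K ∂μ p := fun p => by
    rw [← lintegral_iSup (fun K => hf.min measurable_const)
      (fun m n h y => min_le_min le_rfl (by exact_mod_cast h))]
    refine lintegral_congr fun y => ?_
    rw [← inf_iSup_eq, ENNReal.iSup_natCast, inf_top_eq]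
  simp_rw [hsup]
  refine lowerSemicontinuous_iSup fun K => ?_
  have hne : ∀ y, min (f y) (K : ℝ≥0∞) ≠ ⊤ := fun y =>
    ne_top_of_le_ne_top (ENNReal.natCast_ne_top K) (min_le_right _ _)
  have hcake : ∀ p, ∫⁻ y, min (f y) K ∂μ p =
      ∫⁻ t in Ioi (0 : ℝ), μ p {y | t < (min (f y) (K : ℝ≥0∞)).toReal} := fun p => by
    rw [← lintegral_eq_lintegral_meas_lt (μ p) (ae_of_all _ fun y => ENNReal.toReal_nonneg)
      (hf.min measurable_const).ennreal_toReal.aemeasurable]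
    exact lintegral_congr fun y => (ENNReal.ofReal_toReal (hne y)).symm
  simp_rw [hcake]
  have hlsc : ∀ t ∈ Ioi (0 : ℝ),
      LowerSemicontinuous fun p => μ p {y | t < (min (f y) (K : ℝ≥0∞)).toReal} := by
    intro t ht
    have hset : {y | t < (min (f y) (K : ℝ≥0∞)).toReal} =
        {y | ENNReal.ofReal t < f y ∧ ENNReal.ofReal t < K} := by
      ext y
      rw [Set.mem_ofPred_eq, Set.mem_ofPred_eq, ← lt_min_iff,
        ENNReal.ofReal_lt_iff_lt_toReal (le_of_lt ht) (hne y)]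
    rw [hset]
    by_cases hK : ENNReal.ofReal t < K
    · simpa [hK] using hμ (ENNReal.ofReal t)
    · simpa [hK] using lowerSemicontinuous_const
  rw [lowerSemicontinuous_iff_le_liminf]
  intro p
  refine le_trans ?_ (lintegral_liminf_le fun p => Antitone.measurable fun s t hst =>
    measure_mono fun y hy => lt_of_le_of_lt hst hy)
  exact setLIntegral_mono' measurableSet_Ioi fun t ht =>
    lowerSemicontinuous_iff_le_liminf.1 (hlsc t ht) p

theorem lowerSemicontinuous_iInf_of_isCompact {X A : Type*} [MetricSpace X] [TopologicalSpace A]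
    [T2Space A] [Nonempty A] {F : X × A → ℝ≥0∞}
    (hF : ∀ K : Set X, K.Nonempty → IsCompact K → ∀ r : ℝ≥0∞, r ≠ ⊤ →
      IsCompact {z : X × A | z.1 ∈ K ∧ F z ≤ r}) :
    LowerSemicontinuous fun x => ⨅ b, F (x, b) := by
  have hsec : ∀ x, InfCompact fun b => F (x, b) := fun x r hr => by
    convert (hF {x} (singleton_nonempty x) isCompact_singleton r hr).image continuous_snd using 1
    ext b
    simp
  intro x₀ y hy
  by_contra hcon
  rw [Filter.not_eventually] at hcon
  obtain ⟨x, hx, hxy⟩ := exists_seq_forall_of_frequently hcon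
  have hK := hx.isCompact_insert_range
  have hy' : y ≠ ⊤ := hy.ne_top
  have hcl := ((hF _ (insert_nonempty _ _) hK y hy').image continuous_fst).isClosed
  have hmem : x₀ ∈ Prod.fst '' {z : X × A | z.1 ∈ insert x₀ (range x) ∧ F z ≤ y} := by
    refine hcl.mem_of_tendsto hx (Eventually.of_forall fun n => ?_)
    obtain ⟨b, hb⟩ := (hsec (x n)).exists_eq_iInf
    exact ⟨(x n, b), ⟨mem_insert_of_mem _ (mem_range_self n), hb.trans_le (not_lt.1 (hxy n))⟩, rfl⟩
  obtain ⟨⟨x', b⟩, ⟨-, hb⟩, rfl⟩ := hmem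
  exact absurd ((iInf_le _ b).trans hb) (not_le.2 hy)

end LowerSemicontinuity

section WeakContinuity

variable {X A : Type*} [MeasurableSpace X] [MeasurableSpace A] {M : MDP X A} {κ : ℝ≥0}

theorem shiftCost_le_iff {r : ℝ≥0∞} (hr : r ≠ ⊤) (x : X) (b : A) :
    shiftCost M κ (x, b) ≤ r ↔ M.c x b ≤ ((r.toReal - κ : ℝ) : EReal) := by
  lift r to ℝ≥0 using hr
  rw [shiftCost, ← EReal.coe_ennreal_le_coe_ennreal_iff, EReal.coe_toENNReal_eq_max, max_le_iff,
    and_iff_right (EReal.coe_ennreal_nonneg _), EReal.coe_sub,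
    EReal.le_sub_iff_add_le (Or.inl (EReal.coe_ne_bot _)) (Or.inl (EReal.coe_ne_top _))]
  rfl

variable [MetricSpace X] [MetricSpace A]

theorem AssumptionWi.isCompact (h : AssumptionWi M) {K : Set X} (hne : K.Nonempty)
    (hK : IsCompact K) {r : ℝ≥0∞} (hr : r ≠ ⊤) :
    IsCompact {z : X × A | z.1 ∈ K ∧ shiftCost M κ z ≤ r} := by
  convert h K hne hK (r.toReal - κ) using 3 with z
  exact and_congr_right fun _ => shiftCost_le_iff hr z.1 z.2

theorem AssumptionWii.lowerSemicontinuous_lintegral [BorelSpace X]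
    (h : AssumptionWii M) {f : X → ℝ≥0∞}
    (hf : LowerSemicontinuous f) : LowerSemicontinuous fun z => ∫⁻ y, f y ∂M.q z := by
  have := M.markov
  refine _root_.lowerSemicontinuous_lintegral _ hf.measurable fun t => ?_
  rw [lowerSemicontinuous_iff_le_liminf]
  intro z
  let ν : X × A → ProbabilityMeasure X := fun z => ⟨M.q z, inferInstance⟩
  have hν : Tendsto ν (𝓝 z) (𝓝 (ν z)) :=
    ProbabilityMeasure.tendsto_iff_forall_integral_tendsto.2 fun g => (h g).tendsto z
  exact ProbabilityMeasure.le_liminf_measure_open_of_tendsto hν (hf.isOpen_preimage t)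

theorem isValueClass_lowerSemicontinuous [BorelSpace X] [Nonempty A] (h₁ : AssumptionWi M)
    (h₂ : AssumptionWii M) :
    IsValueClass M κ LowerSemicontinuous where
  zero := lowerSemicontinuous_const
  measurable f hf := hf.measurable
  lintegral f hf x := (h₂.lowerSemicontinuous_lintegral hf).comp (by fun_prop)
  bellman f hf β hβ := by
    have hI : LowerSemicontinuous fun z => β * ∫⁻ y, f y ∂M.q z :=
      (h₂.lowerSemicontinuous_lintegral hf).ennreal_const_mul hβ
    refine lowerSemicontinuous_iInf_of_isCompact
      (F := fun z => shiftCost M κ z + β * ∫⁻ y, f y ∂M.q z) fun K hne hK r hr => ?_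
    classical
    have hg : InfCompact fun z : X × A => if z.1 ∈ K then shiftCost M κ z else ⊤ := by
      intro s hs
      convert h₁.isCompact (κ := κ) hne hK hs using 3 with z
      by_cases hz : z.1 ∈ K <;> simp [hz, hs]
    convert hg.add hI r hr using 3 with z
    by_cases hz : z.1 ∈ K <;> simp [hz, hr]
  iSup f hf _ := by
    convert lowerSemicontinuous_iSup hf with x
    exact iSup_apply
  shiftCost x r hr := by
    convert (h₁.isCompact (κ := κ) (singleton_nonempty x) isCompact_singleton hr).image
      continuous_snd using 1
    ext b
    simp

end WeakContinuity

section SetwiseContinuity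

variable {X A : Type*} [MeasurableSpace X] [StandardBorelSpace X]
  [MetricSpace A] [TopologicalSpace.SeparableSpace A]
  [MeasurableSpace A] [BorelSpace A] [StandardBorelSpace A]
  {M : MDP X A} {κ : ℝ≥0}

theorem isValueClass_measurable (h₁ : AssumptionSi M) (h₂ : AssumptionSii M) :
    IsValueClass M κ Measurable := by
  have hI : ∀ f : X → ℝ≥0∞, Measurable f → ∀ x,
      LowerSemicontinuous fun b => ∫⁻ y, f y ∂M.q (x, b) := fun f hf x =>
    lowerSemicontinuous_lintegral (fun b => M.q (x, b)) hf fun t =>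
      (h₂ x _ (measurableSet_lt measurable_const hf)).lowerSemicontinuous
  have hc : ∀ x, InfCompact fun b => shiftCost M κ (x, b) := fun x r hr => by
    convert h₁ x (r.toReal - κ) using 3 with b
    exact shiftCost_le_iff hr x b
  exact
  { zero := measurable_zero
    measurable := fun f hf => hf
    lintegral := hI
    bellman := fun f hf β hβ => measurable_iInf_of_infCompact
      (F := fun z => shiftCost M κ z + β * ∫⁻ y, f y ∂M.q z)
      ((measurable_shiftCost M κ).add (hf.lintegral_kernel.const_mul _))
      fun x => (hc x).add ((hI f hf x).ennreal_const_mul hβ)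
    iSup := fun f hf _ => by
      convert Measurable.iSup hf with x
      exact iSup_apply
    shiftCost := hc }

end SetwiseContinuity

section VanishingDiscount

theorem tendsto_lintegral_min {Y : Type*} [MeasurableSpace Y] (μ : Measure Y) [IsFiniteMeasure μ]
    {U : ℕ → Y → ℝ≥0∞} {u : Y → ℝ≥0∞} (hU : ∀ n, Measurable (U n))
    (hu : ∀ y, Tendsto (fun n => U n y) atTop (𝓝 (u y))) (K : ℝ≥0) :
    Tendsto (fun n => ∫⁻ y, min (U n y) K ∂μ) atTop (𝓝 (∫⁻ y, min (u y) K ∂μ)) := by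
  refine tendsto_lintegral_of_dominated_convergence (fun _ => (K : ℝ≥0∞))
    (fun n => (hU n).min measurable_const) (fun n => ae_of_all _ fun y => min_le_right _ _) ?_
    (ae_of_all _ fun y => (hu y).min tendsto_const_nhds)
  rw [lintegral_const]
  finiteness

theorem lintegral_le_lintegral_min_add {Y : Type*} [MeasurableSpace Y] (μ : Measure Y)
    {f : Y → ℝ≥0∞} (hf : Measurable f) (K : ℝ≥0∞) :
    ∫⁻ y, f y ∂μ ≤ ∫⁻ y, min (f y) K ∂μ + ∫⁻ y in {y | K ≤ f y}, f y ∂μ := by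
  have hs : MeasurableSet {y | K ≤ f y} := measurableSet_le measurable_const hf
  rw [← lintegral_indicator hs, ← lintegral_add_left (hf.min measurable_const)]
  refine lintegral_mono fun y => ?_
  by_cases h : K ≤ f y
  · rw [indicator_of_mem (by exact h)]
    exact le_add_self
  · rw [min_eq_left (not_le.1 h).le]
    exact le_self_add

variable {X A : Type*} [MeasurableSpace X] [MeasurableSpace A] {M : MDP X A} {κ : ℝ≥0}

/-- The discounted value function for the shifted cost relative to its infimum. -/
def relValue (M : MDP X A) (κ : ℝ≥0) (β : ℝ≥0∞) (x : X) : ℝ≥0∞ :=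
  shiftValue M κ β x - ⨅ x, shiftValue M κ β x

theorem bellman_relValue {β : ℝ≥0∞} (hβ : β ≤ 1)
    (hV : bellman M κ β (shiftValue M κ β) = shiftValue M κ β)
    (hm : ⨅ x, shiftValue M κ β x ≠ ⊤) (x : X) :
    bellman M κ β (relValue M κ β) x =
      (1 - β) * (⨅ x, shiftValue M κ β x) + relValue M κ β x := by
  have := M.markov
  set m := ⨅ x, shiftValue M κ β x with hm'
  have hsplit : ∀ y, shiftValue M κ β y = m + relValue M κ β y := fun y =>
    (add_tsub_cancel_of_le (iInf_le _ y)).symm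
  have hβm : β * m ≠ ⊤ := ENNReal.mul_ne_top (ne_top_of_le_ne_top ENNReal.one_ne_top hβ) hm
  refine (ENNReal.add_right_inj hβm).1 ?_
  calc β * m + bellman M κ β (relValue M κ β) x
      = bellman M κ β (shiftValue M κ β) x := by
        rw [bellman, bellman, ENNReal.add_iInf]
        refine iInf_congr fun b => ?_
        simp_rw [hsplit]
        rw [lintegral_add_left measurable_const, lintegral_const, measure_univ]
        ring
    _ = (β + (1 - β)) * m + relValue M κ β x := by
        rw [hV, hsplit, add_tsub_cancel_of_le hβ, one_mul]
    _ = _ := by ring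

variable {β : ℕ → ℝ≥0∞} {u : X → ℝ≥0}

theorem iSup_iInf_relValue
    (hu : ∀ x, Tendsto (fun n => relValue M κ (β n) x) atTop (𝓝 (u x : ℝ≥0∞))) :
    (⨆ n, fun x => ⨅ k ≥ n, relValue M κ (β k) x) = fun x => (u x : ℝ≥0∞) := by
  funext x
  rw [iSup_apply, ← liminf_eq_iSup_iInf_of_nat]
  exact (hu x).liminf_eq

theorem monotone_iInf_relValue : Monotone fun n (x : X) => ⨅ k ≥ n, relValue M κ (β k) x :=
  fun _ _ h _ => biInf_mono fun _ hk => h.trans hk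

theorem iInf_shiftCost_add_lintegral_le [TopologicalSpace A] [T2Space A] [Nonempty A]
    {C : (X → ℝ≥0∞) → Prop} (hC : IsValueClass M κ C)
    (hmono : Monotone β) (hβ : ∀ n, β n ≤ 1) (hβ1 : ⨆ n, β n = 1)
    (hV : ∀ n, bellman M κ (β n) (shiftValue M κ (β n)) = shiftValue M κ (β n))
    (hm : ∀ n, ⨅ x, shiftValue M κ (β n) x ≠ ⊤)
    (hW : ∀ n, C fun x => ⨅ k ≥ n, relValue M κ (β k) x)
    (hu : ∀ x, Tendsto (fun n => relValue M κ (β n) x) atTop (𝓝 (u x : ℝ≥0∞))) {w : ℝ≥0}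
    (hw : Tendsto (fun n => (1 - β n) * ⨅ x, shiftValue M κ (β n) x) atTop (𝓝 (w : ℝ≥0∞)))
    (x : X) : ⨅ b, (shiftCost M κ (x, b) + ∫⁻ y, u y ∂M.q (x, b)) ≤ w + u x := by
  have h := iInf_shiftCost_add_lintegral_iSup hC hW monotone_iInf_relValue hmono
    (fun n => ne_top_of_le_ne_top ENNReal.one_ne_top (hβ n)) x
  rw [hβ1, iSup_iInf_relValue hu] at h
  simp only [one_mul] at h
  rw [h]
  refine iSup_le fun n => ?_
  refine ge_of_tendsto (hw.add (hu x)) ?_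
  filter_upwards [eventually_ge_atTop n] with k hk
  rw [← bellman_relValue (hβ k) (hV k) (hm k) x]
  refine iInf_mono fun b => add_le_add_right (mul_le_mul' (hmono hk) (lintegral_mono fun y => ?_)) _
  exact iInf₂_le k hk

theorem add_le_shiftCost_add_lintegral (hβ : ∀ n, β n ≤ 1)
    (hV : ∀ n, bellman M κ (β n) (shiftValue M κ (β n)) = shiftValue M κ (β n))
    (hm : ∀ n, ⨅ x, shiftValue M κ (β n) x ≠ ⊤)
    (hU : ∀ n, Measurable (relValue M κ (β n)))
    (hu : ∀ x, Tendsto (fun n => relValue M κ (β n) x) atTop (𝓝 (u x : ℝ≥0∞))) {w : ℝ≥0}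
    (hw : Tendsto (fun n => (1 - β n) * ⨅ x, shiftValue M κ (β n) x) atTop (𝓝 (w : ℝ≥0∞)))
    (x : X) (b : A)
    (hUI : ∀ ε : ℝ≥0, 0 < ε → ∃ K : ℝ≥0, ∀ᶠ n in atTop,
      ∫⁻ y in {y | (K : ℝ≥0∞) ≤ relValue M κ (β n) y}, relValue M κ (β n) y ∂M.q (x, b) ≤ ε) :
    w + u x ≤ shiftCost M κ (x, b) + ∫⁻ y, u y ∂M.q (x, b) := by
  have := M.markov
  refine ENNReal.le_of_forall_pos_le_add fun ε hε _ => ?_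
  obtain ⟨K, hK⟩ := hUI ε hε
  have hlim := ((tendsto_lintegral_min (M.q (x, b)) hU hu K).const_add
    (shiftCost M κ (x, b))).add_const (ε : ℝ≥0∞)
  refine (le_of_tendsto_of_tendsto (hw.add (hu x)) hlim ?_).trans ?_
  · filter_upwards [hK] with n hn
    rw [← bellman_relValue (hβ n) (hV n) (hm n) x]
    calc _ ≤ shiftCost M κ (x, b) + β n * ∫⁻ y, relValue M κ (β n) y ∂M.q (x, b) := iInf_le _ b
      _ ≤ shiftCost M κ (x, b) + 1 * (∫⁻ y, min (relValue M κ (β n) y) K ∂M.q (x, b) + ε) := by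
        gcongr
        · exact hβ n
        · exact (lintegral_le_lintegral_min_add _ (hU n) K).trans (by gcongr)
      _ = _ := by ring
  · gcongr
    exact min_le_left _ _

end VanishingDiscount

theorem EReal.tendsto_of_tendsto_sub {P : ℕ → ℝ≥0∞} {k w : ℝ}
    (h : Tendsto (fun n => (P n : EReal) - (k : EReal)) atTop (𝓝 ((w - k : ℝ) : EReal))) :
    Tendsto P atTop (𝓝 (ENNReal.ofReal w)) := by
  have h1 : Tendsto (fun n => ((P n : EReal) - (k : EReal)) + (k : EReal)) atTop
      (𝓝 (((w - k : ℝ) : EReal) + (k : EReal))) :=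
    (EReal.continuousAt_add (p := (((w - k : ℝ) : EReal), (k : EReal))) (by simp)
      (by simp)).tendsto.comp (h.prodMk_nhds tendsto_const_nhds)
  have h2 := (EReal.continuous_toENNReal.tendsto _).comp h1
  rw [← EReal.coe_add, _root_.sub_add_cancel, EReal.real_coe_toENNReal] at h2
  convert h2 using 1
  funext n
  simp only [Function.comp_apply, EReal.sub_add_cancel, EReal.toENNReal_coe]

theorem EReal.coe_ennreal_sub_add (P Q : ℝ≥0∞) (k : ℝ) :
    ((P : EReal) - (k : EReal)) + (Q : EReal) = ((P + Q : ℝ≥0∞) : EReal) - (k : EReal) := by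
  simpa using EReal.coe_ennreal_sub_add_sub P Q k 0

theorem lowerSemicontinuous_iInf_of_equicontinuous {X : Type*} [TopologicalSpace X]
    {U : ℕ → X → ℝ≥0∞}
    (hU : ∀ x, ∀ ε : ℝ≥0, 0 < ε → ∀ᶠ y in 𝓝 x, ∀ n, U n x ≤ U n y + ε) (n : ℕ) :
    LowerSemicontinuous fun x => ⨅ k ≥ n, U k x := by
  intro x r hr
  obtain ⟨ε, hε, hlt⟩ := ENNReal.lt_iff_exists_add_pos_lt.1 hr
  filter_upwards [hU x ε hε] with y hy
  have h : ⨅ k ≥ n, U k x ≤ (⨅ k ≥ n, U k y) + ε := by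
    simp_rw [ENNReal.iInf_add]
    exact iInf₂_mono fun k _ => hy k
  exact lt_of_add_lt_add_right (hlt.trans_le h)

section RelativeValue

variable {X A : Type*} [MeasurableSpace X] [MeasurableSpace A] {M : MDP X A} {κ : ℝ≥0} {a : ℕ → ℝ}

theorem MDP.exists_shift (M : MDP X A) : ∃ κ : ℝ≥0, ∀ x b, ((-κ : ℝ) : EReal) ≤ M.c x b := by
  obtain ⟨K, hK⟩ := M.c_ne_bot
  refine ⟨Real.toNNReal (-K), fun x b => le_trans ?_ (hK x b)⟩
  rw [EReal.coe_le_coe_iff]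
  linarith [Real.le_coe_toNNReal (-K)]

theorem nonempty_of_wStar_lt_top (h : wStar M < ⊤) : Nonempty X ∧ Nonempty A := by
  obtain ⟨x, hx⟩ := iInf_lt_iff.1 h
  obtain ⟨p, -⟩ := iInf_lt_iff.1 hx
  have := p.markov 0
  exact ⟨⟨x⟩, nonempty_of_isProbabilityMeasure (p.π 0 (Fin.elim0, x))⟩

theorem LECtwo.eventually_iInf_shiftValue_ne_top [Nonempty X]
    (hκ : ∀ x b, ((-κ : ℝ) : EReal) ≤ M.c x b) (ha : ∀ n, a n ∈ Ico (0 : ℝ) 1)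
    (h : LECtwo M a) :
    ∀ᶠ n in atTop, ⨅ x, shiftValue M κ (ENNReal.ofReal (a n)) x ≠ ⊤ := by
  obtain ⟨x⟩ := ‹Nonempty X›
  obtain ⟨L, hL⟩ := h x
  filter_upwards [hL.eventually (lt_mem_nhds (EReal.bot_lt_coe L))] with n hn htop
  have hm : mDisc M (a n) = ⊤ := by
    rw [mDisc_eq hκ (ha n), htop]
    exact EReal.top_sub_coe _
  rw [uDisc, hm, EReal.sub_top] at hn
  exact lt_irrefl _ hn

theorem LECone.eventually_relValue_le [MetricSpace X] {n₀ : ℕ} (h : LECone M a)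
    (hu : ∀ n x, uDisc M (a (n + n₀)) x = relValue M κ (ENNReal.ofReal (a (n + n₀))) x)
    (x : X) (ε : ℝ≥0) (hε : 0 < ε) :
    ∀ᶠ y in 𝓝 x, ∀ n, relValue M κ (ENNReal.ofReal (a (n + n₀))) x ≤
      relValue M κ (ENNReal.ofReal (a (n + n₀))) y + ε := by
  obtain ⟨δ, hδ, hball⟩ := h x ε hε
  filter_upwards [Metric.ball_mem_nhds x hδ] with y hy n
  have h' := (hball y hy (n + n₀)).le
  rw [hu, hu, EReal.coe_ennreal_sub_le_iff] at h'
  refine EReal.coe_ennreal_le_coe_ennreal_iff.1 (h'.trans_eq ?_)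
  rw [EReal.coe_ennreal_add]
  rfl

theorem LECthree.eventually_setLIntegral_relValue_le {n₀ : ℕ} (h : LECthree M a)
    (hu : ∀ n x, uDisc M (a (n + n₀)) x = relValue M κ (ENNReal.ofReal (a (n + n₀))) x)
    (x : X) (b : A) (ε : ℝ≥0) (hε : 0 < ε) :
    ∃ K : ℝ≥0, ∀ᶠ n in atTop,
      ∫⁻ y in {y | (K : ℝ≥0∞) ≤ relValue M κ (ENNReal.ofReal (a (n + n₀))) y},
        relValue M κ (ENNReal.ofReal (a (n + n₀))) y ∂M.q (x, b) ≤ ε := by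
  obtain ⟨K, hK, hK0⟩ := (((h x b).eventually (gt_mem_nhds (ENNReal.coe_pos.2 hε))).and
    (eventually_ge_atTop 0)).exists
  refine ⟨⟨K, hK0⟩, ?_⟩
  filter_upwards [(tendsto_add_atTop_nat n₀).eventually (eventually_lt_of_limsup_lt hK)] with n hn
  have hset : {y | ENNReal.ofNNReal ⟨K, hK0⟩ ≤ relValue M κ (ENNReal.ofReal (a (n + n₀))) y} =
      {y | (K : EReal) ≤ relValue M κ (ENNReal.ofReal (a (n + n₀))) y} := by
    ext y
    exact EReal.coe_ennreal_le_coe_ennreal_iff.symm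
  simp only [hu, eToENN_coe] at hn
  rw [hset]
  exact hn.le

end RelativeValue

section ValueClassInstances

variable {X A : Type*} [MetricSpace X] [MeasurableSpace X] [BorelSpace X] [StandardBorelSpace X]
  [MetricSpace A] [TopologicalSpace.SeparableSpace A]
  [MeasurableSpace A] [BorelSpace A] [StandardBorelSpace A]

theorem exists_isValueClass {M : MDP X A} {κ : ℝ≥0} {a : ℕ → ℝ} [Nonempty A]
    (hWS : (AssumptionWi M ∧ AssumptionWii M ∧ LECone M a ∧ LECtwo M a ∧ LECthree M a)
      ∨ (AssumptionSi M ∧ AssumptionSii M ∧ LECtwo M a ∧ LECthree M a)) {n₀ : ℕ}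
    (hu : ∀ n x, uDisc M (a (n + n₀)) x = relValue M κ (ENNReal.ofReal (a (n + n₀))) x) :
    ∃ C, IsValueClass M κ C ∧
      ∀ n, C fun x => ⨅ k ≥ n, relValue M κ (ENNReal.ofReal (a (k + n₀))) x := by
  rcases hWS with ⟨h₁, h₂, h₃, -⟩ | ⟨h₁, h₂, -⟩
  · exact ⟨_, isValueClass_lowerSemicontinuous h₁ h₂,
      lowerSemicontinuous_iInf_of_equicontinuous (h₃.eventually_relValue_le hu)⟩
  · have hC : IsValueClass M κ Measurable := isValueClass_measurable h₁ h₂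
    exact ⟨_, hC, fun n => Measurable.iInf fun k => Measurable.iInf fun _ =>
      (hC.shiftValue_mem ENNReal.ofReal_ne_top).sub_const _⟩

end ValueClassInstances

section Optimality

variable {X A : Type*} [MeasurableSpace X] [StandardBorelSpace X]
  [MetricSpace A] [TopologicalSpace.SeparableSpace A]
  [MeasurableSpace A] [BorelSpace A] [StandardBorelSpace A]

/-- The optimality equation and the bound on the average cost, for the shifted cost. -/
theorem exists_measurable_optimal (M : MDP X A) {κ : ℝ≥0} {C : (X → ℝ≥0∞) → Prop} [Nonempty A]
    (hC : IsValueClass M κ C) {β : ℕ → ℝ≥0∞} {u : X → ℝ≥0} (hmono : Monotone β)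
    (hβ : ∀ n, β n ≤ 1) (hβ1 : ⨆ n, β n = 1)
    (hm : ∀ n, ⨅ x, shiftValue M κ (β n) x ≠ ⊤)
    (hW : ∀ n, C fun x => ⨅ k ≥ n, relValue M κ (β k) x)
    (hu : ∀ x, Tendsto (fun n => relValue M κ (β n) x) atTop (𝓝 (u x : ℝ≥0∞))) {w : ℝ≥0}
    (hw : Tendsto (fun n => (1 - β n) * ⨅ x, shiftValue M κ (β n) x) atTop (𝓝 (w : ℝ≥0∞)))
    (hUI : ∀ x b, ∀ ε : ℝ≥0, 0 < ε → ∃ K : ℝ≥0, ∀ᶠ n in atTop,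
      ∫⁻ y in {y | (K : ℝ≥0∞) ≤ relValue M κ (β n) y}, relValue M κ (β n) y ∂M.q (x, b) ≤ ε) :
    Measurable u ∧
    (∀ x, ⨅ b, (shiftCost M κ (x, b) + ∫⁻ y, u y ∂M.q (x, b)) = w + u x) ∧
    ∃ φ : X → A, Measurable φ ∧ ∀ x,
      shiftCost M κ (x, φ x) + ∫⁻ y, u y ∂M.q (x, φ x) = w + u x := by
  have hβ' : ∀ n, β n ≠ ⊤ := fun n => ne_top_of_le_ne_top ENNReal.one_ne_top (hβ n)
  have hV := fun n => hC.bellman_shiftValue (hβ' n)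
  have hUm : ∀ n, Measurable (relValue M κ (β n)) := fun n =>
    (hC.measurable _ (hC.shiftValue_mem (hβ' n))).sub_const _
  have huC : C fun x => (u x : ℝ≥0∞) := by
    rw [← iSup_iInf_relValue hu]
    exact hC.iSup _ hW monotone_iInf_relValue
  have heq : ∀ x, ⨅ b, (shiftCost M κ (x, b) + ∫⁻ y, u y ∂M.q (x, b)) = w + u x := fun x =>
    le_antisymm (iInf_shiftCost_add_lintegral_le hC hmono hβ hβ1 hV hm hW hu hw x)
      (le_iInf fun b => add_le_shiftCost_add_lintegral hβ hV hm hUm hu hw x b (hUI x b))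
  obtain ⟨φ, hφ, hmin⟩ := hC.exists_measurable_minimizer huC ENNReal.one_ne_top
  simp only [bellman, one_mul] at hmin
  exact ⟨measurable_coe_nnreal_ennreal_iff.1 (hC.measurable _ huC), heq, φ, hφ,
    fun x => (hmin x).trans (heq x)⟩

end Optimality

section Statements

variable {X A : Type*} [MetricSpace X] [TopologicalSpace.SeparableSpace X]
  [MeasurableSpace X] [BorelSpace X] [StandardBorelSpace X]
  [MetricSpace A] [TopologicalSpace.SeparableSpace A]
  [MeasurableSpace A] [BorelSpace A] [StandardBorelSpace A]

/-- Corollary 3.13. Suppose that for a sequence `α_n ↑ 1` either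
(a) Assumptions W*, B̲_{{α_n}} and LEC_{{α_n}} hold, or (b) Assumptions S*, B̲_{{α_n}},
LEC_{{α_n}}(ii) and LEC_{{α_n}}(iii) hold. If in addition `(1-α_n) m_{α_n} → w̲`, then
`w* = w̄ = w̲` and there is a deterministic policy `φ` such that, with
`u(x) := lim_{n→∞} u_{α_n}(x)`, the ACOE holds with `w̲` in place of `w*`. -/
theorem statement7
    (M : MDP X A)
    (a : ℕ → ℝ)
    (ha : ∀ n, a n ∈ Set.Ico (0 : ℝ) 1) (hamono : Monotone a)
    (hatend : Tendsto a atTop (𝓝 (1 : ℝ)))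
    (hB1 : wStar M < ⊤)
    (hB2 : ∀ x, Filter.liminf (fun n => uDisc M (a n) x) atTop < ⊤)
    (hWS : (AssumptionWi M ∧ AssumptionWii M ∧ LECone M a ∧ LECtwo M a ∧ LECthree M a)
      ∨ (AssumptionSi M ∧ AssumptionSii M ∧ LECtwo M a ∧ LECthree M a))
    (hconv : Tendsto (fun n : ℕ => ((1 - a n : ℝ) : EReal) * mDisc M (a n)) atTop
      (𝓝 (wLow M))) :
    wStar M = wBar M ∧ wBar M = wLow M
    ∧ ∃ (φ : X → A) (_ : Measurable φ), ∀ x : X,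
        wLow M + uPointwise M a x
          = M.c x (φ x) + eInt (M.q (x, φ x)) (uPointwise M a)
        ∧ M.c x (φ x) + eInt (M.q (x, φ x)) (uPointwise M a)
          = ⨅ b : A, (M.c x b + eInt (M.q (x, b)) (uPointwise M a)) := by
  obtain ⟨hX, hA⟩ := nonempty_of_wStar_lt_top hB1
  obtain ⟨κ, hκ⟩ := M.exists_shift
  have hL2 : LECtwo M a := hWS.elim (fun h => h.2.2.2.1) fun h => h.2.2.1
  have hL3 : LECthree M a := hWS.elim (fun h => h.2.2.2.2) fun h => h.2.2.2
  obtain ⟨n₀, hn₀⟩ := eventually_atTop.1 (hL2.eventually_iInf_shiftValue_ne_top hκ ha)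
  have hm : ∀ n, ⨅ x, shiftValue M κ (ENNReal.ofReal (a (n + n₀))) x ≠ ⊤ := fun n =>
    hn₀ _ (Nat.le_add_left _ _)
  have hu : ∀ n x, uDisc M (a (n + n₀)) x = relValue M κ (ENNReal.ofReal (a (n + n₀))) x :=
    fun n => uDisc_eq hκ (ha _) (hm n)
  obtain ⟨C, hC, hW⟩ := exists_isValueClass hWS hu
  have hshift := tendsto_add_atTop_nat n₀
  choose L hL using hL2
  have hrel : ∀ x, Tendsto (fun n => relValue M κ (ENNReal.ofReal (a (n + n₀))) x) atTop
      (𝓝 ((L x).toNNReal : ℝ≥0∞)) := fun x => by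
    have h := (EReal.continuous_toENNReal.tendsto _).comp ((hL x).comp hshift)
    simp only [Function.comp_def, hu, EReal.toENNReal_coe] at h
    exact h
  have hupt : uPointwise M a = fun x => (((L x).toNNReal : ℝ≥0∞) : EReal) := by
    funext x
    rw [uPointwise, (hL x).liminf_eq]
    refine tendsto_nhds_unique ((hL x).comp hshift) ?_
    simpa only [Function.comp_def, hu] using EReal.tendsto_coe_ennreal.2 (hrel x)
  have hchain : wLow M ≤ wStar M := wLow_le_wBar.trans (wBar_le_wStar hκ)
  obtain ⟨w, hw⟩ : ∃ w : ℝ≥0, wLow M = ((w - κ : ℝ) : EReal) := by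
    have hlow := neg_le_wLow hκ
    lift wLow M to ℝ using ⟨(hchain.trans_lt hB1).ne, fun h => by
      rw [h] at hlow; exact absurd (le_bot_iff.1 hlow) (EReal.coe_ne_bot _)⟩ with l
    refine ⟨⟨l + κ, ?_⟩, ?_⟩
    · linarith [EReal.coe_le_coe_iff.1 hlow]
    · congr 1
      change l = l + κ - κ
      ring
  have hwlim : Tendsto (fun n => (1 - ENNReal.ofReal (a (n + n₀))) *
      ⨅ x, shiftValue M κ (ENNReal.ofReal (a (n + n₀))) x) atTop (𝓝 (w : ℝ≥0∞)) := by
    have h := hconv.comp hshift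
    simp only [Function.comp_def, one_sub_mul_mDisc_eq hκ (ha _), hw] at h
    simpa using EReal.tendsto_of_tendsto_sub h
  have hβmono : Monotone fun n => ENNReal.ofReal (a (n + n₀)) := fun m n h =>
    ENNReal.ofReal_le_ofReal (hamono (by omega))
  have hβ1 : ⨆ n, ENNReal.ofReal (a (n + n₀)) = 1 := by
    refine tendsto_nhds_unique (tendsto_atTop_iSup hβmono) ?_
    simpa using ENNReal.tendsto_ofReal (hatend.comp hshift)
  obtain ⟨humeas, heq, φ, hφ, hmin⟩ := exists_measurable_optimal M hC hβmono
    (fun n => by simpa using (ha (n + n₀)).2.le) hβ1 hm hW hrel hwlim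
    (hL3.eventually_setLIntegral_relValue_le hu)
  have hle : wStar M ≤ wLow M := by
    obtain ⟨x⟩ := hX
    rw [hw]
    exact (iInf_le_of_le x (iInf_le _ (detPolicy φ hφ))).trans
      (avgCost_detPolicy_le hκ humeas hφ (fun x => (hmin x).le) x)
  refine ⟨le_antisymm (hle.trans wLow_le_wBar) (wBar_le_wStar hκ),
    le_antisymm ((wBar_le_wStar hκ).trans hle) wLow_le_wBar, φ, hφ, fun x => ?_⟩
  have hrhs : ∀ b, M.c x b + eInt (M.q (x, b)) (uPointwise M a) =
      ((shiftCost M κ (x, b) + ∫⁻ y, (L y).toNNReal ∂M.q (x, b) : ℝ≥0∞) : EReal) -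
        ((κ : ℝ) : EReal) := fun b => by
    rw [hupt, eInt_coe, ← coe_shiftCost_sub hκ, EReal.coe_ennreal_sub_add]
  have hlhs : wLow M + uPointwise M a x =
      ((w + (L x).toNNReal : ℝ≥0∞) : EReal) - ((κ : ℝ) : EReal) := by
    rw [hw, hupt, ← EReal.coe_ennreal_sub_add]
    rfl
  simp only [hrhs, hlhs, EReal.iInf_coe_ennreal_sub, heq, hmin, and_self]

end Statements

end
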